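/- arXiv:0802.0420 — 6 statements merged into one kernel-verified Lean document; each statement's English description precedes it below -/
import Mathlib

section
/- Every 2-dimensional lattice polytope Δ ⊂ ℝ² with exactly one interior lattice point has a facet (edge) containing at most 4 lattice points. -/
noncomputable section

/-- The embedding of the integer lattice `ℤ²` into the plane `ℝ²`. -/
def toR2 (p : ℤ × ℤ) : ℝ × ℝ := ((p.1 : ℝ), (p.2 : ℝ))

/-- A lattice polytope in `ℝ²`: the convex hull of a finite set of lattice points. -/
def IsLatticePolytope (Δ : Set (ℝ × ℝ)) : Prop :=
  ∃ S : Finset (ℤ × ℤ), Δ = convexHull ℝ (toR2 '' (S : Set (ℤ × ℤ)))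

/-- The lattice points of `Δ`. -/
def latticePts (Δ : Set (ℝ × ℝ)) : Set (ℤ × ℤ) := {p | toR2 p ∈ Δ}

/-- The interior lattice points of `Δ`. -/
def intPts (Δ : Set (ℝ × ℝ)) : Set (ℤ × ℤ) := {p | toR2 p ∈ interior Δ}

/-- The boundary lattice points of `Δ`. -/
def bdPts (Δ : Set (ℝ × ℝ)) : Set (ℤ × ℤ) := {p | toR2 p ∈ frontier Δ}

/-- `Δ⁽¹⁾`: the convex hull of the interior lattice points of `Δ`. -/
def interiorHull (Δ : Set (ℝ × ℝ)) : Set (ℝ × ℝ) := convexHull ℝ (toR2 '' intPts Δ)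

/-- `Δ` is maximal: any lattice polytope strictly containing `Δ` has a different set of
interior lattice points. -/
def IsMaximalPolytope (Δ : Set (ℝ × ℝ)) : Prop :=
  ∀ Δ' : Set (ℝ × ℝ), IsLatticePolytope Δ' → Δ ⊂ Δ' → intPts Δ' ≠ intPts Δ

/-- `Δ` is hyperelliptic: its interior lattice points are collinear. -/
def IsHyperelliptic (Δ : Set (ℝ × ℝ)) : Prop := Collinear ℝ (toR2 '' intPts Δ)

/-- A facet (edge) of `Δ`: a one-dimensional exposed face. -/
def IsFacet (Δ τ : Set (ℝ × ℝ)) : Prop :=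
  IsExposed ℝ Δ τ ∧ Collinear ℝ τ ∧ ¬ τ.Subsingleton

/-- `v` is a column vector of `Δ`: `v ≠ 0` and there is a facet `τ` (the base facet)
such that `v + ((Δ ∖ τ) ∩ ℤ²) ⊆ Δ`. -/
def IsColumnVector (Δ : Set (ℝ × ℝ)) (v : ℤ × ℤ) : Prop :=
  v ≠ 0 ∧ ∃ τ : Set (ℝ × ℝ), IsFacet Δ τ ∧
    ∀ p : ℤ × ℤ, toR2 p ∈ Δ \ τ → toR2 (p + v) ∈ Δ

/-- `c(Δ)`: the number of column vectors of `Δ`. -/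
def colCount (Δ : Set (ℝ × ℝ)) : ℕ := {v : ℤ × ℤ | IsColumnVector Δ v}.ncard

/-- An affine inequality valid on a set of lattice points is valid on its convex hull. -/
lemma le_on_convexHull {S : Set (ℤ × ℤ)} {a b c : ℤ}
    (h : ∀ q ∈ S, c ≤ a * q.1 + b * q.2) :
    ∀ x ∈ convexHull ℝ (toR2 '' S), (c : ℝ) ≤ a * x.1 + b * x.2 := by
  have hconv : Convex ℝ {x : ℝ × ℝ | (c : ℝ) ≤ a * x.1 + b * x.2} := by
    intro x hx y hy s t hs ht hst
    simp only [Set.mem_ofPred_eq, Prod.fst_add, Prod.snd_add, Prod.smul_fst, Prod.smul_snd,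
      smul_eq_mul] at *
    obtain rfl : t = 1 - s := by linarith
    nlinarith [mul_le_mul_of_nonneg_left hx hs, mul_le_mul_of_nonneg_left hy ht]
  refine fun x hx => convexHull_min ?_ hconv hx
  rintro _ ⟨q, hq, rfl⟩
  simp only [Set.mem_ofPred_eq, toR2]
  exact_mod_cast h q hq

/-- A set of points of the plane on a line through `B` with direction `v` is collinear. -/
lemma collinear_of_cross_eq_zero {T : Set (ℝ × ℝ)} {B v : ℝ × ℝ} (hv : v ≠ 0)
    (h : ∀ x ∈ T, v.1 * (x.2 - B.2) = v.2 * (x.1 - B.1)) : Collinear ℝ T := by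
  rw [collinear_iff_exists_forall_eq_smul_vadd]
  refine ⟨B, v, fun x hx => ?_⟩
  have hx' := h x hx
  by_cases h1 : v.1 = 0
  · have h2 : v.2 ≠ 0 := fun h2 => hv (Prod.ext h1 h2)
    refine ⟨(x.2 - B.2) / v.2, Prod.ext ?_ ?_⟩ <;>
      simp only [vadd_eq_add, Prod.fst_add, Prod.snd_add, Prod.smul_fst, Prod.smul_snd,
        smul_eq_mul]
    · rw [h1, zero_mul] at hx'
      have := (mul_eq_zero.1 hx'.symm).resolve_left h2
      rw [h1]; linarith
    · field_simp; ring
  · refine ⟨(x.1 - B.1) / v.1, Prod.ext ?_ ?_⟩ <;>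
      simp only [vadd_eq_add, Prod.fst_add, Prod.snd_add, Prod.smul_fst, Prod.smul_snd,
        smul_eq_mul]
    · field_simp; ring
    · field_simp; linarith

/-- A nonzero lattice vector is a positive multiple of a lattice vector `u` generating all the
lattice vectors on its line. -/
lemma exists_primitive {v : ℤ × ℤ} (hv : v ≠ 0) :
    ∃ (d : ℤ) (u : ℤ × ℤ), 0 < d ∧ v = d • u ∧
      ∀ w : ℤ × ℤ, v.1 * w.2 = v.2 * w.1 → ∃ k : ℤ, w = k • u := by
  have hg : 0 < Int.gcd v.1 v.2 := by
    rw [Nat.pos_iff_ne_zero, Ne, Int.gcd_eq_zero_iff]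
    exact fun h => hv (Prod.ext h.1 h.2)
  obtain ⟨a, b, hab, h1, h2⟩ := Int.exists_gcd_one hg
  have hd : (0 : ℤ) < Int.gcd v.1 v.2 := by exact_mod_cast hg
  obtain ⟨x, y, hxy⟩ := Int.isCoprime_iff_gcd_eq_one.2 hab
  refine ⟨Int.gcd v.1 v.2, (a, b), hd, Prod.ext ?_ ?_, fun w hw => ?_⟩
  · simpa [mul_comm] using h1
  · simpa [mul_comm] using h2
  · have hw' : a * w.2 = b * w.1 := by
      refine mul_left_cancel₀ hd.ne' ?_
      linear_combination hw - w.2 * h1 + w.1 * h2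
    refine ⟨x * w.1 + y * w.2, Prod.ext ?_ ?_⟩ <;> simp only [Prod.smul_fst, Prod.smul_snd,
      smul_eq_mul]
    · linear_combination (-w.1) * hxy - y * hw'
    · linear_combination (-w.2) * hxy + x * hw'

/-- The points of a lattice polygon on a supporting line spanned by two of its lattice points
form a facet. -/
lemma isFacet_of_supporting {S : Set (ℤ × ℤ)} {B v : ℤ × ℤ} {e : ℤ} (he : e ≠ 0) (hB : B ∈ S)
    (hv : v ≠ 0) (hvS : B + v ∈ S)
    (hsup : ∀ q ∈ S, 0 ≤ e * (v.1 * (q.2 - B.2) - v.2 * (q.1 - B.1))) :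
    IsFacet (convexHull ℝ (toR2 '' S)) {x | x ∈ convexHull ℝ (toR2 '' S) ∧
      (v.1 : ℝ) * (x.2 - B.2) = v.2 * (x.1 - B.1)} := by
  have hBΔ : toR2 B ∈ convexHull ℝ (toR2 '' S) := subset_convexHull _ _ ⟨B, hB, rfl⟩
  have hvΔ : toR2 (B + v) ∈ convexHull ℝ (toR2 '' S) := subset_convexHull _ _ ⟨_, hvS, rfl⟩
  have he' : (e : ℝ) ≠ 0 := by exact_mod_cast he
  have hΔ := le_on_convexHull (S := S) (a := -(e * v.2)) (b := e * v.1)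
    (c := e * (v.1 * B.2 - v.2 * B.1)) (fun q hq => by linarith [hsup q hq])
  push_cast at hΔ
  refine ⟨fun _ => ⟨((e * v.2 : ℝ) • ContinuousLinearMap.fst ℝ ℝ ℝ -
    (e * v.1 : ℝ) • ContinuousLinearMap.snd ℝ ℝ ℝ), ?_⟩, ?_, ?_⟩
  · ext x
    simp only [Set.mem_ofPred_eq, sub_apply, smul_apply,
      ContinuousLinearMap.coe_fst', ContinuousLinearMap.coe_snd', smul_eq_mul]
    refine and_congr_right fun hx => ⟨fun h y hy => ?_, fun h => ?_⟩
    · linear_combination hΔ y hy + (e : ℝ) * h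
    · have h1 := h _ hBΔ
      have h2 := hΔ x hx
      simp only [toR2] at h1
      apply mul_left_cancel₀ he'
      linarith
  · refine collinear_of_cross_eq_zero (B := toR2 B) (v := toR2 v) ?_ fun x hx => hx.2
    intro h
    apply hv
    simpa [toR2, Prod.ext_iff] using h
  · intro h
    have := h ⟨hBΔ, by simp [toR2]⟩ ⟨hvΔ, by simp [toR2]; ring⟩
    apply hv
    simpa [toR2, Prod.ext_iff] using this

/-- Along an edge starting at a vertex `B` and having more than four lattice points, one can move
by four times a lattice vector. -/
lemma exists_long_edge_vector {S : Set (ℤ × ℤ)} {B v : ℤ × ℤ} {a b e : ℤ} (he : e ≠ 0)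
    (hB : B ∈ S) (hvS : B + v ∈ S) (hfv : 0 < a * v.1 + b * v.2)
    (hf : ∀ q ∈ S, a * B.1 + b * B.2 ≤ a * q.1 + b * q.2)
    (hsup : ∀ q ∈ S, 0 ≤ e * (v.1 * (q.2 - B.2) - v.2 * (q.1 - B.1)))
    (hlong : ∀ τ, IsFacet (convexHull ℝ (toR2 '' S)) τ → 4 < {p : ℤ × ℤ | toR2 p ∈ τ}.ncard) :
    ∃ (d : ℤ) (u : ℤ × ℤ), 0 < d ∧ v = d • u ∧
      toR2 (B + (4 : ℤ) • u) ∈ convexHull ℝ (toR2 '' S) := by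
  have hv : v ≠ 0 := by rintro rfl; simp at hfv
  obtain ⟨d, u, hd, hdu, hu⟩ := exists_primitive hv
  refine ⟨d, u, hd, hdu, ?_⟩
  have hfu : 0 < a * u.1 + b * u.2 := by
    rw [hdu] at hfv
    simp only [Prod.smul_fst, Prod.smul_snd, smul_eq_mul] at hfv
    exact pos_of_mul_pos_right (a := d) (by linarith) hd.le
  have hfacet := hlong _ (isFacet_of_supporting he hB hv hvS hsup)
  have hmult : ∀ p : ℤ × ℤ, toR2 p ∈ convexHull ℝ (toR2 '' S) →
      (v.1 : ℝ) * (p.2 - B.2) = v.2 * (p.1 - B.1) → ∃ k : ℤ, 0 ≤ k ∧ p = B + k • u := by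
    intro p hp hline
    obtain ⟨k, hk⟩ := hu (p - B) (by simp only [Prod.fst_sub, Prod.snd_sub]; exact_mod_cast hline)
    obtain rfl : p = B + k • u := by rw [← hk]; abel
    refine ⟨k, ?_, rfl⟩
    have h := le_on_convexHull hf _ hp
    simp only [toR2] at h
    have h' : a * B.1 + b * B.2 ≤ a * (B + k • u).1 + b * (B + k • u).2 := by exact_mod_cast h
    simp only [Prod.fst_add, Prod.snd_add, Prod.smul_fst, Prod.smul_snd, smul_eq_mul] at h'
    exact nonneg_of_mul_nonneg_left (b := a * u.1 + b * u.2) (by linarith) hfu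
  obtain ⟨k, hk, hkΔ⟩ : ∃ k : ℤ, 4 ≤ k ∧ toR2 (B + k • u) ∈ convexHull ℝ (toR2 '' S) := by
    by_contra! hcon
    refine absurd hfacet (not_lt.2 ?_)
    have hsub : {p : ℤ × ℤ | toR2 p ∈ {x | x ∈ convexHull ℝ (toR2 '' S) ∧
        (v.1 : ℝ) * (x.2 - B.2) = v.2 * (x.1 - B.1)}} ⊆
        (((Finset.Ico (0 : ℤ) 4).image fun k => B + k • u : Finset (ℤ × ℤ)) : Set (ℤ × ℤ)) := by
      rintro p ⟨hp, hline⟩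
      obtain ⟨k, hk, rfl⟩ := hmult p hp hline
      have : k < 4 := not_le.1 fun h => hcon k h hp
      rw [Finset.coe_image]
      exact ⟨k, by simp [hk, this], rfl⟩
    refine (Set.ncard_le_ncard hsub (Finset.finite_toSet _)).trans ?_
    rw [Set.ncard_coe_finset]
    exact Finset.card_image_le.trans (by simp)
  have hk' : (4 : ℝ) ≤ k := by exact_mod_cast hk
  have hconv := (convex_convexHull ℝ (toR2 '' S)) (subset_convexHull ℝ _ ⟨B, hB, rfl⟩) hkΔ
    (a := 1 - 4 / k) (b := 4 / k) (by rw [sub_nonneg, div_le_one] <;> linarith)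
    (by positivity) (by ring)
  convert hconv using 1
  have hk0 : (k : ℝ) ≠ 0 := by positivity
  ext <;> simp [toR2] <;> field_simp <;> ring

/-- A lattice point strictly inside a triangle with a vertex `B` is interior to any convex set
containing the triangle. -/
lemma mem_interior_of_triangle {Δ : Set (ℝ × ℝ)} (hΔ : Convex ℝ Δ) {B u w : ℤ × ℤ}
    (hcross : 0 < u.1 * w.2 - u.2 * w.1) (hB : toR2 B ∈ Δ)
    {n : ℤ} (hu : toR2 (B + n • u) ∈ Δ) (hw : toR2 (B + n • w) ∈ Δ) {i j : ℤ}
    (hi : 0 < i) (hj : 0 < j) (hij : i + j < n) : toR2 (B + i • u + j • w) ∈ interior Δ := by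
  have hD : (0 : ℝ) < u.1 * w.2 - u.2 * w.1 := by exact_mod_cast hcross
  have hn : (0 : ℝ) < n := by exact_mod_cast (by lia : 0 < n)
  have hi' : (0 : ℝ) < i := by exact_mod_cast hi
  have hj' : (0 : ℝ) < j := by exact_mod_cast hj
  have hij' : (i + j : ℝ) < n := by exact_mod_cast hij
  set D : ℝ := u.1 * w.2 - u.2 * w.1 with hDdef
  let s : ℝ × ℝ → ℝ := fun x => ((x.1 - B.1) * w.2 - (x.2 - B.2) * w.1) / D
  let t : ℝ × ℝ → ℝ := fun x => (u.1 * (x.2 - B.2) - u.2 * (x.1 - B.1)) / D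
  have hs : Continuous s := by fun_prop
  have ht : Continuous t := by fun_prop
  have hopen : IsOpen {x | 0 < s x ∧ 0 < t x ∧ s x + t x < n} :=
    (isOpen_lt continuous_const hs).inter
      ((isOpen_lt continuous_const ht).inter (isOpen_lt (hs.add ht) continuous_const))
  refine interior_maximal ?_ hopen ?_
  · rintro x ⟨h1, h2, h3⟩
    have hx1 : x.1 = B.1 + s x * u.1 + t x * w.1 := by
      simp only [s, t]; field_simp; rw [hDdef]; ring
    have hx2 : x.2 = B.2 + s x * u.2 + t x * w.2 := by
      simp only [s, t]; field_simp; rw [hDdef]; ring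
    have hmem := hΔ.sum_mem (t := Finset.univ) (w := ![1 - (s x + t x) / n, s x / n, t x / n])
      (z := ![toR2 B, toR2 (B + n • u), toR2 (B + n • w)])
      (by
        intro l _
        fin_cases l
        · simpa using (div_le_one hn).2 h3.le
        · exact (div_pos h1 hn).le
        · exact (div_pos h2 hn).le)
      (by simp [Fin.sum_univ_three]; ring)
      (by intro l _; fin_cases l <;> assumption)
    convert hmem using 1
    generalize s x = σ at *
    generalize t x = θ at *
    apply Prod.ext
    · rw [hx1]; simp [Fin.sum_univ_three, toR2]; field_simp; ring
    · rw [hx2]; simp [Fin.sum_univ_three, toR2]; field_simp; ring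
  · have hsi : s (toR2 (B + i • u + j • w)) = i := by
      simp only [s, toR2]; rw [div_eq_iff hD.ne', hDdef]; simp; ring
    have htj : t (toR2 (B + i • u + j • w)) = j := by
      simp only [t, toR2]; rw [div_eq_iff hD.ne', hDdef]; simp; ring
    simp only [Set.mem_ofPred_eq, hsi, htj]
    exact ⟨hi', hj', hij'⟩

/-- A finite set of at least two lattice points has a point exposed by an integral linear form. -/
lemma exists_exposed_lattice_point {S : Finset (ℤ × ℤ)} (hS : S.Nontrivial) :
    ∃ B ∈ S, ∃ a b : ℤ, ∀ q ∈ S, q ≠ B → 0 < a * (q.1 - B.1) + b * (q.2 - B.2) := by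
  obtain ⟨B, hB, hmax⟩ := S.exists_max_image (fun p => p.1 ^ 2 + p.2 ^ 2) hS.nonempty
  refine ⟨B, hB, -B.1, -B.2, fun q hq hne => ?_⟩
  have h := hmax q hq
  have hpos : 0 < (q.1 - B.1) ^ 2 + (q.2 - B.2) ^ 2 := by
    by_contra! hle
    have h1 : (q.1 - B.1) ^ 2 = 0 := by nlinarith [sq_nonneg (q.1 - B.1), sq_nonneg (q.2 - B.2)]
    have h2 : (q.2 - B.2) ^ 2 = 0 := by nlinarith [sq_nonneg (q.1 - B.1), sq_nonneg (q.2 - B.2)]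
    exact hne (Prod.ext (sub_eq_zero.1 (pow_eq_zero_iff two_ne_zero |>.1 h1))
      (sub_eq_zero.1 (pow_eq_zero_iff two_ne_zero |>.1 h2)))
  nlinarith

/-- Among finitely many vectors in an open half-plane, one is extremal in the clockwise
direction. -/
lemma exists_clockwise_extremal {T : Finset (ℤ × ℤ)} (hT : T.Nonempty) {a b : ℤ}
    (hpos : ∀ q ∈ T, 0 < a * q.1 + b * q.2) :
    ∃ v ∈ T, ∀ q ∈ T, 0 ≤ v.1 * q.2 - v.2 * q.1 := by
  obtain ⟨v, hv, hmin⟩ := T.exists_min_image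
    (fun q => ((a * q.2 - b * q.1 : ℤ) : ℚ) / ((a * q.1 + b * q.2 : ℤ) : ℚ)) hT
  refine ⟨v, hv, fun q hq => ?_⟩
  have h := hmin q hq
  rw [div_le_div_iff₀ (by exact_mod_cast hpos v hv) (by exact_mod_cast hpos q hq)] at h
  have h' : (a * v.2 - b * v.1) * (a * q.1 + b * q.2) ≤
      (a * q.2 - b * q.1) * (a * v.1 + b * v.2) := by exact_mod_cast h
  have hab : 0 < a ^ 2 + b ^ 2 := by
    by_contra! hle
    have ha : a = 0 := by nlinarith [sq_nonneg a, sq_nonneg b]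
    have hb : b = 0 := by nlinarith [sq_nonneg a, sq_nonneg b]
    simpa [ha, hb] using hpos v hv
  exact nonneg_of_mul_nonneg_right (a := a ^ 2 + b ^ 2) (by linarith) hab

/-- every 2-dimensional lattice polytope `Δ ⊂ ℝ²` with exactly one
interior lattice point has a facet containing at most 4 lattice points. -/
theorem exists_facet_with_few_lattice_points (Δ : Set (ℝ × ℝ))
    (hlat : IsLatticePolytope Δ) (hdim : ¬ Collinear ℝ Δ)
    (hone : (intPts Δ).ncard = 1) :
    ∃ τ : Set (ℝ × ℝ), IsFacet Δ τ ∧ {p : ℤ × ℤ | toR2 p ∈ τ}.ncard ≤ 4 := by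
  by_contra! hlong
  obtain ⟨S, rfl⟩ := hlat
  have hS : S.Nontrivial := by
    by_contra h
    have hsub : (toR2 '' (S : Set (ℤ × ℤ))).Subsingleton :=
      (Set.not_nontrivial_iff.1 h).image toR2
    rcases hsub.eq_empty_or_singleton with h | ⟨x, h⟩
    · exact hdim (by simp [h, collinear_empty])
    · exact hdim (by simp [h, collinear_singleton])
  obtain ⟨B, hB, a, b, hexp⟩ := exists_exposed_lattice_point hS
  have hf : ∀ q ∈ (S : Set (ℤ × ℤ)), a * B.1 + b * B.2 ≤ a * q.1 + b * q.2 := by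
    intro q hq
    by_cases hqB : q = B
    · rw [hqB]
    · linarith [hexp q hq hqB]
  set T := (S.erase B).image (fun q => q - B) with hT
  have hTne : T.Nonempty := (hS.erase_nonempty).image _
  have hTpos : ∀ q ∈ T, 0 < a * q.1 + b * q.2 := by
    simp only [hT, Finset.mem_image, Finset.mem_erase]
    rintro _ ⟨q, ⟨hne, hq⟩, rfl⟩
    exact hexp q hq hne
  have hTS : ∀ v ∈ T, B + v ∈ (S : Set (ℤ × ℤ)) := by
    simp only [hT, Finset.mem_image, Finset.mem_erase]
    rintro _ ⟨q, ⟨hne, hq⟩, rfl⟩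
    simpa using hq
  have hST : ∀ q ∈ (S : Set (ℤ × ℤ)), q = B ∨ q - B ∈ T := fun q hq =>
    or_iff_not_imp_left.2 fun h => Finset.mem_image_of_mem _ (Finset.mem_erase.2 ⟨h, hq⟩)
  obtain ⟨v, hvT, hv⟩ := exists_clockwise_extremal hTne hTpos
  -- Reflecting in the diagonal turns clockwise into counterclockwise.
  obtain ⟨w', hw'T, hw'⟩ := exists_clockwise_extremal (T := T.image Prod.swap) (a := b) (b := a)
    (hTne.image _) (by
      simp only [Finset.mem_image]
      rintro _ ⟨q, hq, rfl⟩
      simpa [add_comm] using hTpos q hq)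
  obtain ⟨w, hwT, rfl⟩ := Finset.mem_image.1 hw'T
  have hw : ∀ q ∈ T, 0 ≤ w.2 * q.1 - w.1 * q.2 := fun q hq => by
    simpa using hw' q.swap (Finset.mem_image_of_mem _ hq)
  have hvS : ∀ q ∈ (S : Set (ℤ × ℤ)), 0 ≤ 1 * (v.1 * (q.2 - B.2) - v.2 * (q.1 - B.1)) := by
    intro q hq
    rcases hST q hq with rfl | h
    · simp
    · simpa using hv _ h
  have hwS : ∀ q ∈ (S : Set (ℤ × ℤ)), 0 ≤ -1 * (w.1 * (q.2 - B.2) - w.2 * (q.1 - B.1)) := by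
    intro q hq
    rcases hST q hq with rfl | h
    · simp
    · simpa using hw _ h
  have hcross : 0 < v.1 * w.2 - v.2 * w.1 := by
    refine lt_of_le_of_ne (hv w hwT) fun h0 => hdim ?_
    have hzero : ∀ q ∈ (S : Set (ℤ × ℤ)), v.1 * (q.2 - B.2) - v.2 * (q.1 - B.1) ≤ 0 := by
      intro q hq
      refine nonpos_of_mul_nonpos_right (a := a * w.1 + b * w.2) ?_ (hTpos w hwT)
      have h1 := mul_nonneg (hTpos v hvT).le (hwS q hq)
      linear_combination h1 - (a * (q.1 - B.1) + b * (q.2 - B.2)) * h0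
    have hle := le_on_convexHull (S := S) (a := -v.2) (b := v.1)
      (c := v.1 * B.2 - v.2 * B.1) (fun q hq => by linarith [hvS q hq])
    have hge := le_on_convexHull (S := S) (a := v.2) (b := -v.1)
      (c := -(v.1 * B.2 - v.2 * B.1)) (fun q hq => by linarith [hzero q hq])
    push_cast at hle hge
    refine collinear_of_cross_eq_zero (B := toR2 B) (v := toR2 v) ?_ fun x hx => ?_
    · intro h
      have hv0 : v = 0 := by simpa [toR2, Prod.ext_iff] using h
      simpa [hv0] using hTpos v hvT
    · simp only [toR2]
      linarith [hle x hx, hge x hx]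
  obtain ⟨d, u, hd, rfl, hu⟩ := exists_long_edge_vector one_ne_zero hB (hTS v hvT)
    (hTpos v hvT) hf hvS hlong
  obtain ⟨d', u', hd', rfl, hu'⟩ := exists_long_edge_vector (by norm_num) hB (hTS w hwT)
    (hTpos w hwT) hf hwS hlong
  have hcross' : 0 < u.1 * u'.2 - u.2 * u'.1 := by
    simp only [Prod.smul_fst, Prod.smul_snd, smul_eq_mul] at hcross
    exact pos_of_mul_pos_right (a := d * d') (by linarith) (mul_pos hd hd').le
  have hinterior : ∀ i j : ℤ, 0 < i → 0 < j → i + j < 4 →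
      B + i • u + j • u' ∈ intPts (convexHull ℝ (toR2 '' (S : Set (ℤ × ℤ)))) :=
    fun i j => mem_interior_of_triangle (convex_convexHull ℝ _) hcross'
      (subset_convexHull ℝ _ (Set.mem_image_of_mem toR2 hB)) hu hu'
  obtain ⟨c, hc⟩ := Set.ncard_eq_one.1 hone
  have h1 := hinterior 1 1 (by norm_num) (by norm_num) (by norm_num)
  have h2 := hinterior 2 1 (by norm_num) (by norm_num) (by norm_num)
  rw [hc, Set.mem_singleton_iff] at h1 h2
  have hu0 : u = 0 := by
    have h3 := h2.trans h1.symm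
    simp only [two_smul, one_smul, add_left_inj, add_right_inj] at h3
    exact left_eq_add.1 h3.symm
  simp [hu0] at hcross'
end
end

section
/- For every integer d ≥ 1, the lattice polytope dΣ = conv{(0,0),(d,0),(0,d)} has exactly 6 column vectors, namely (0,−1), (1,−1), (−1,0), (−1,1), (0,1) and (1,0). -/
noncomputable section

/-- The `d`-fold dilation `dΣ = conv{(0,0),(d,0),(0,d)}` of the standard 2-simplex. -/
def stdSimplexD (d : ℕ) : Set (ℝ × ℝ) :=
  convexHull ℝ ({((0 : ℝ), (0 : ℝ)), ((d : ℝ), 0), (0, (d : ℝ))} : Set (ℝ × ℝ))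

/-- The dilated simplex is cut out by the inequalities `0 ≤ x`, `0 ≤ y`, `x + y ≤ d`. -/
theorem mem_stdSimplexD {d : ℕ} (hd : 1 ≤ d) (p : ℝ × ℝ) :
    p ∈ stdSimplexD d ↔ 0 ≤ p.1 ∧ 0 ≤ p.2 ∧ p.1 + p.2 ≤ d := by
  have hd' : (0 : ℝ) < d := by exact_mod_cast hd
  obtain ⟨x, y⟩ := p
  constructor
  · intro h
    have hconv : Convex ℝ {p : ℝ × ℝ | 0 ≤ p.1 ∧ 0 ≤ p.2 ∧ p.1 + p.2 ≤ d} := by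
      rintro ⟨a, b⟩ ⟨ha, hb, hab⟩ ⟨a', b'⟩ ⟨ha', hb', hab'⟩ s t hs ht hst
      simp only [Set.mem_ofPred_eq, Prod.smul_mk, Prod.mk_add_mk, smul_eq_mul] at *
      refine ⟨by positivity, by positivity, ?_⟩
      calc s * a + t * a' + (s * b + t * b') = s * (a + b) + t * (a' + b') := by ring
        _ ≤ s * d + t * d := by gcongr
        _ = d := by rw [← add_mul, hst, one_mul]
    refine convexHull_min ?_ hconv h
    rintro q (rfl | rfl | rfl) <;> simp
  · rintro ⟨hx, hy, hxy⟩
    simp only at hx hy hxy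
    rw [stdSimplexD, convexHull_insert (by simp), convexHull_pair]
    simp only [segment_eq_image, convexJoin_singleton_left, Set.mem_iUnion]
    rcases (add_nonneg hx hy).eq_or_lt' with h0 | h0
    · obtain rfl : x = 0 := by linarith
      obtain rfl : y = 0 := by linarith
      exact ⟨_, ⟨0, by simp, rfl⟩, 0, by simp, by simp⟩
    · refine ⟨_, ⟨y / (x + y), ⟨by positivity, ?_⟩, rfl⟩, (x + y) / d, ⟨by positivity, ?_⟩, ?_⟩
      · rw [div_le_one h0]; linarith
      · rwa [div_le_one hd']
      · ext
        · simp; field_simp; ring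
        · simp; field_simp

/-- Integral version of `mem_stdSimplexD`. -/
theorem toR2_mem_stdSimplexD {d : ℕ} (hd : 1 ≤ d) (p : ℤ × ℤ) :
    toR2 p ∈ stdSimplexD d ↔ 0 ≤ p.1 ∧ 0 ≤ p.2 ∧ p.1 + p.2 ≤ d := by
  rw [mem_stdSimplexD hd]
  simp only [toR2]
  norm_cast

/-- A supporting line meeting `Δ` in at least two points cuts out a facet. -/
theorem isFacet_of_supporting_line {Δ : Set (ℝ × ℝ)} {a b c : ℝ} (hab : a ^ 2 + b ^ 2 ≠ 0)
    (hle : ∀ q ∈ Δ, a * q.1 + b * q.2 ≤ c) {p q : ℝ × ℝ} (hp : p ∈ Δ) (hq : q ∈ Δ)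
    (hpq : p ≠ q) (hpc : a * p.1 + b * p.2 = c) (hqc : a * q.1 + b * q.2 = c) :
    IsFacet Δ {r ∈ Δ | a * r.1 + b * r.2 = c} := by
  refine ⟨fun _ => ⟨a • ContinuousLinearMap.fst ℝ ℝ ℝ + b • ContinuousLinearMap.snd ℝ ℝ ℝ, ?_⟩,
    ?_, fun h => hpq (h ⟨hp, hpc⟩ ⟨hq, hqc⟩)⟩
  · ext r
    simp only [Set.mem_ofPred_eq, add_apply, smul_apply,
      ContinuousLinearMap.coe_fst', ContinuousLinearMap.coe_snd', smul_eq_mul]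
    refine and_congr_right fun hr => ⟨fun h s hs => h ▸ hle s hs, fun h => ?_⟩
    exact le_antisymm (hle r hr) (hpc ▸ h p hp)
  · rw [collinear_iff_exists_forall_eq_smul_vadd]
    refine ⟨p, (-b, a), fun r hr => ⟨(a * (r.2 - p.2) - b * (r.1 - p.1)) / (a ^ 2 + b ^ 2), ?_⟩⟩
    have hr' : a * (r.1 - p.1) + b * (r.2 - p.2) = 0 := by linear_combination hr.2 - hpc
    ext
    · simp only [vadd_eq_add, Prod.smul_mk, Prod.fst_add, smul_eq_mul]
      field_simp
      linear_combination a * hr'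
    · simp only [vadd_eq_add, Prod.smul_mk, Prod.snd_add, smul_eq_mul]
      field_simp
      linear_combination b * hr'

/-- The three vertices of the dilated simplex are not collinear. -/
theorem not_collinear_stdSimplexD {d : ℕ} (hd : 1 ≤ d) : ¬ Collinear ℝ (stdSimplexD d) := by
  have hd' : (0 : ℝ) < d := by exact_mod_cast hd
  intro h
  rw [collinear_iff_of_mem (p₀ := (0, 0)) (by simp [mem_stdSimplexD hd])] at h
  obtain ⟨v, hv⟩ := h
  obtain ⟨s, hs⟩ := hv (d, 0) (by simp [mem_stdSimplexD hd])
  obtain ⟨t, ht⟩ := hv (0, d) (by simp [mem_stdSimplexD hd])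
  simp only [vadd_eq_add, Prod.ext_iff, Prod.fst_add, Prod.snd_add, Prod.smul_fst, Prod.smul_snd,
    smul_eq_mul, add_zero] at hs ht
  have : (d : ℝ) * d = 0 := by
    calc (d : ℝ) * d = (s * v.1) * (t * v.2) := by rw [← hs.1, ← ht.2]
      _ = (s * v.2) * (t * v.1) := by ring
      _ = 0 := by rw [← hs.2, zero_mul]
  exact (mul_pos hd' hd').ne' this

/-- Every facet of the dilated simplex lies on one of its three sides. -/
theorem IsFacet.subset_side {d : ℕ} (hd : 1 ≤ d) {τ : Set (ℝ × ℝ)}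
    (h : IsFacet (stdSimplexD d) τ) :
    (∀ p ∈ τ, p.1 = 0) ∨ (∀ p ∈ τ, p.2 = 0) ∨ (∀ p ∈ τ, p.1 + p.2 = d) := by
  obtain ⟨hexp, hcol, hns⟩ := h
  obtain ⟨l, rfl⟩ := hexp (Set.not_subsingleton_iff.mp hns).nonempty
  obtain ⟨a, b, hl⟩ : ∃ a b : ℝ, ∀ p, l p = a * p.1 + b * p.2 := by
    refine ⟨l (1, 0), l (0, 1), fun p => ?_⟩
    have hp : p = p.1 • ((1, 0) : ℝ × ℝ) + p.2 • ((0, 1) : ℝ × ℝ) := by ext <;> simp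
    conv_lhs => rw [hp, map_add, map_smul, map_smul]
    simp only [smul_eq_mul]
    ring
  simp only [Set.mem_ofPred_eq, hl, mem_stdSimplexD hd] at *
  rcases lt_or_ge a 0 with ha | ha
  · left
    rintro p ⟨⟨hx, hy, hxy⟩, hmax⟩
    have := hmax (0, p.2) ⟨le_rfl, hy, by simp only; linarith⟩
    simp only at this
    nlinarith
  rcases lt_or_ge b 0 with hb | hb
  · right; left
    rintro p ⟨⟨hx, hy, hxy⟩, hmax⟩
    have := hmax (p.1, 0) ⟨hx, le_rfl, by simp only; linarith⟩
    simp only at this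
    nlinarith
  rcases ha.eq_or_lt' with rfl | ha
  · rcases hb.eq_or_lt' with rfl | hb
    · refine absurd hcol ?_
      convert not_collinear_stdSimplexD hd using 2
      ext p
      simp [mem_stdSimplexD hd]
    · right; right
      rintro p ⟨⟨hx, hy, hxy⟩, hmax⟩
      have := hmax (p.1, d - p.1) ⟨hx, by simp only; linarith, by simp⟩
      simp only at this
      nlinarith
  · right; right
    rintro p ⟨⟨hx, hy, hxy⟩, hmax⟩
    have := hmax (d - p.2, p.2) ⟨by simp only; linarith, hy, by simp⟩
    simp only at this
    nlinarith

/-- for every integer `d ≥ 1`, the polytope `dΣ` has exactly 6 column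
vectors, namely `(0,−1), (1,−1), (−1,0), (−1,1), (0,1), (1,0)`. -/
theorem columnVectors_stdSimplexD (d : ℕ) (hd : 1 ≤ d) :
    {v : ℤ × ℤ | IsColumnVector (stdSimplexD d) v} =
      ({((0 : ℤ), (-1 : ℤ)), (1, -1), (-1, 0), (-1, 1), (0, 1), (1, 0)} :
        Set (ℤ × ℤ)) := by
  have hd' : (0 : ℝ) < d := by exact_mod_cast hd
  have hleft : IsFacet (stdSimplexD d) {r ∈ stdSimplexD d | (-1) * r.1 + 0 * r.2 = 0} :=
    isFacet_of_supporting_line (p := (0, 0)) (q := (0, d)) (by norm_num)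
      (fun q hq => by linarith [((mem_stdSimplexD hd q).1 hq).1])
      (by simp [mem_stdSimplexD hd]) (by simp [mem_stdSimplexD hd])
      (by simpa using hd'.ne) (by simp) (by simp)
  have hbottom : IsFacet (stdSimplexD d) {r ∈ stdSimplexD d | 0 * r.1 + (-1) * r.2 = 0} :=
    isFacet_of_supporting_line (p := (0, 0)) (q := (d, 0)) (by norm_num)
      (fun q hq => by linarith [((mem_stdSimplexD hd q).1 hq).2.1])
      (by simp [mem_stdSimplexD hd]) (by simp [mem_stdSimplexD hd])
      (by simpa using hd'.ne) (by simp) (by simp)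
  have hdiag : IsFacet (stdSimplexD d) {r ∈ stdSimplexD d | 1 * r.1 + 1 * r.2 = d} :=
    isFacet_of_supporting_line (p := (d, 0)) (q := (0, d)) (by norm_num)
      (fun q hq => by linarith [((mem_stdSimplexD hd q).1 hq).2.2])
      (by simp [mem_stdSimplexD hd]) (by simp [mem_stdSimplexD hd])
      (fun h => hd'.ne' (congrArg Prod.fst h)) (by simp) (by simp)
  ext ⟨r, s⟩
  simp only [Set.mem_ofPred_eq, Set.mem_insert_iff, Set.mem_singleton_iff, Prod.mk.injEq]
  constructor
  · rintro ⟨hv, τ, hτ, hcol⟩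
    have hv' : ¬ (r = 0 ∧ s = 0) := fun h => hv (by simp [h])
    have key : ∀ x y : ℤ, 0 ≤ x → 0 ≤ y → x + y ≤ d → toR2 (x, y) ∉ τ →
        0 ≤ x + r ∧ 0 ≤ y + s ∧ x + r + (y + s) ≤ d := fun x y hx hy hxy hnot =>
      (toR2_mem_stdSimplexD hd _).1 (hcol (x, y) ⟨(toR2_mem_stdSimplexD hd _).2 ⟨hx, hy, hxy⟩, hnot⟩)
    rcases hτ.subset_side hd with h | h | h
    · have h' : ∀ x y : ℤ, x ≠ 0 → toR2 (x, y) ∉ τ := fun x y hx hm =>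
        hx (by simpa [toR2] using h _ hm)
      have h₁ := key d 0 (by omega) le_rfl (by omega) (h' _ _ (by omega))
      have h₂ := key 1 0 (by omega) le_rfl (by omega) (h' _ _ (by omega))
      omega
    · have h' : ∀ x y : ℤ, y ≠ 0 → toR2 (x, y) ∉ τ := fun x y hy hm =>
        hy (by simpa [toR2] using h _ hm)
      have h₁ := key 0 d le_rfl (by omega) (by omega) (h' _ _ (by omega))
      have h₂ := key 0 1 le_rfl (by omega) (by omega) (h' _ _ (by omega))
      omega
    · have h' : ∀ x y : ℤ, x + y ≠ d → toR2 (x, y) ∉ τ := fun x y hxy hm =>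
        hxy (by have := h _ hm; simp only [toR2] at this; exact_mod_cast this)
      have h₁ := key 0 0 le_rfl le_rfl (by omega) (h' _ _ (by omega))
      have h₂ := key (d - 1) 0 (by omega) le_rfl (by omega) (h' _ _ (by omega))
      omega
  · have reduce : ∀ {a b c : ℤ},
        IsFacet (stdSimplexD d) {r ∈ stdSimplexD d | (a : ℝ) * r.1 + (b : ℝ) * r.2 = (c : ℝ)} →
        ¬ (r = 0 ∧ s = 0) →
        (∀ x y : ℤ, 0 ≤ x → 0 ≤ y → x + y ≤ d → a * x + b * y ≠ c →
          0 ≤ x + r ∧ 0 ≤ y + s ∧ x + r + (y + s) ≤ d) →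
        IsColumnVector (stdSimplexD d) (r, s) := by
      intro a b c hF hv h
      refine ⟨by simpa [Prod.ext_iff] using hv, _, hF, fun p ⟨hp, hp'⟩ => ?_⟩
      obtain ⟨hx, hy, hxy⟩ := (toR2_mem_stdSimplexD hd p).1 hp
      exact (toR2_mem_stdSimplexD hd _).2
        (h p.1 p.2 hx hy hxy fun hc => hp' ⟨hp, by simp only [toR2]; exact_mod_cast hc⟩)
    have cleft := reduce (a := -1) (b := 0) (c := 0) (by simpa using hleft)
    have cbottom := reduce (a := 0) (b := -1) (c := 0) (by simpa using hbottom)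
    have cdiag := reduce (a := 1) (b := 1) (c := d) (by simpa using hdiag)
    rintro (h | h | h | h | h | h)
    · exact cbottom (by omega) (by intros; omega)
    · exact cbottom (by omega) (by intros; omega)
    · exact cleft (by omega) (by intros; omega)
    · exact cleft (by omega) (by intros; omega)
    · exact cdiag (by omega) (by intros; omega)
    · exact cdiag (by omega) (by intros; omega)
end
end

section
/- Let a, b ≥ 3 be coprime integers and let Δ = conv{(0,0),(b,0),(0,a)} ⊂ ℝ². Then the set of column vectors of Δ is exactly {(n, −1) : n = 0, …, ⌊b/a⌋} ∪ {(−1, m) : m = 0, …, ⌊a/b⌋}; in particular c(Δ) = ⌊b/a⌋ + ⌊a/b⌋ + 2. -/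
noncomputable section

/-- The triangle with vertices `(0,0)`, `(b,0)`, `(0,a)`, described by its three inequalities. -/
lemma mem_triangle_iff {a b : ℝ} (ha : 0 < a) (hb : 0 < b) (p : ℝ × ℝ) :
    p ∈ convexHull ℝ ({((0 : ℝ), (0 : ℝ)), (b, 0), (0, a)} : Set (ℝ × ℝ)) ↔
      0 ≤ p.1 ∧ 0 ≤ p.2 ∧ a * p.1 + b * p.2 ≤ a * b := by
  constructor
  · intro h
    have hconv : Convex ℝ {q : ℝ × ℝ | 0 ≤ q.1 ∧ 0 ≤ q.2 ∧ a * q.1 + b * q.2 ≤ a * b} := by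
      rintro ⟨x, y⟩ ⟨hx, hy, hxy⟩ ⟨z, w⟩ ⟨hz, hw, hzw⟩ s t hs ht hst
      simp only [Set.mem_ofPred_eq, Prod.smul_mk, smul_eq_mul, Prod.mk_add_mk] at *
      refine ⟨by positivity, by positivity, ?_⟩
      calc a * (s * x + t * z) + b * (s * y + t * w)
          = s * (a * x + b * y) + t * (a * z + b * w) := by ring
        _ ≤ s * (a * b) + t * (a * b) := by gcongr
        _ = a * b := by rw [← add_mul, hst, one_mul]
    refine convexHull_min ?_ hconv h
    rintro q (rfl | rfl | rfl) <;> simp [ha.le, hb.le, mul_nonneg, mul_comm]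
  · rintro ⟨hx, hy, hxy⟩
    have hmem := (convex_convexHull ℝ
      ({((0 : ℝ), (0 : ℝ)), (b, 0), (0, a)} : Set (ℝ × ℝ))).sum_mem (t := Finset.univ)
      (w := ![1 - p.1 / b - p.2 / a, p.1 / b, p.2 / a])
      (z := ![((0 : ℝ), (0 : ℝ)), (b, 0), (0, a)]) ?_ ?_ ?_
    · convert hmem
      ext <;> simp [Fin.sum_univ_three, ha.ne', hb.ne']
    · intro i _
      fin_cases i
      · have : 1 - p.1 / b - p.2 / a = (a * b - (a * p.1 + b * p.2)) / (a * b) := by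
          field_simp
          ring
        simp only [Fin.zero_eta, Matrix.cons_val_zero, this]
        exact div_nonneg (by linarith) (by positivity)
      · exact div_nonneg hx hb.le
      · exact div_nonneg hy ha.le
    · simp only [Fin.sum_univ_three, Matrix.cons_val]
      ring
    · intro i _
      apply subset_convexHull
      fin_cases i <;> simp

lemma toR2_mem_triangle_iff {a b : ℕ} (ha : 0 < a) (hb : 0 < b) (p : ℤ × ℤ) :
    toR2 p ∈ convexHull ℝ ({((0 : ℝ), (0 : ℝ)), ((b : ℝ), 0), (0, (a : ℝ))} : Set (ℝ × ℝ)) ↔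
      0 ≤ p.1 ∧ 0 ≤ p.2 ∧ a * p.1 + b * p.2 ≤ (a * b : ℤ) := by
  rw [mem_triangle_iff (by exact_mod_cast ha) (by exact_mod_cast hb)]
  simp only [toR2]
  norm_cast

/-- A facet of the triangle lies on one of its three bounding lines. -/
lemma facet_triangle_cases {a b : ℝ} (ha : 0 < a) (hb : 0 < b) {τ : Set (ℝ × ℝ)}
    (hτ : IsFacet (convexHull ℝ ({((0 : ℝ), (0 : ℝ)), (b, 0), (0, a)} : Set (ℝ × ℝ))) τ) :
    (∀ p ∈ τ, p.2 = 0) ∨ (∀ p ∈ τ, p.1 = 0) ∨ (∀ p ∈ τ, a * p.1 + b * p.2 = a * b) := by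
  obtain ⟨hexp, hcol, hsub⟩ := hτ
  obtain ⟨l, rfl⟩ := hexp (Set.not_subsingleton_iff.mp hsub).nonempty
  have hl : ∀ p : ℝ × ℝ, l p = p.1 * l (1, 0) + p.2 * l (0, 1) := fun p ↦ by
    rw [← smul_eq_mul, ← smul_eq_mul, ← map_smul, ← map_smul, ← map_add]
    simp
  set α := l (1, 0)
  set β := l (0, 1)
  have h0 := (mem_triangle_iff ha hb (0, 0)).2 (by simp [ha.le, hb.le, mul_nonneg])
  have h1 := (mem_triangle_iff ha hb (b, 0)).2 (by simp [hb.le])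
  have h2 := (mem_triangle_iff ha hb (0, a)).2 (by simp [ha.le, mul_comm])
  by_contra! hcon
  obtain ⟨⟨p, ⟨hp, hpmax⟩, hp2⟩, ⟨q, ⟨hq, hqmax⟩, hq1⟩, ⟨r, ⟨hr, hrmax⟩, hr0⟩⟩ := hcon
  have hpq := le_antisymm (hqmax p hp) (hpmax q hq)
  have hpr := le_antisymm (hrmax p hp) (hpmax r hr)
  have hm0 := hpmax _ h0
  have hm1 := hpmax _ h1
  have hm2 := hpmax _ h2
  obtain ⟨hpx, hpy, hps⟩ := (mem_triangle_iff ha hb p).1 hp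
  obtain ⟨hqx, hqy, hqs⟩ := (mem_triangle_iff ha hb q).1 hq
  obtain ⟨hrx, hry, hrs⟩ := (mem_triangle_iff ha hb r).1 hr
  have hlp := hl p
  have hlq := hl q
  have hlr := hl r
  rw [hl] at hm0 hm1 hm2
  simp only [zero_mul, add_zero, zero_add] at hm0 hm1 hm2
  set M := l p
  -- A point with positive barycentric weight at a vertex forces that vertex to be maximal.
  have key : ∀ s : ℝ × ℝ, l s = M → a * s.1 * (M - b * α) + b * s.2 * (M - a * β) +
      (a * b - a * s.1 - b * s.2) * M = 0 := fun s hs ↦ by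
    rw [← hs, hl s]
    ring
  have hM2 : M = a * β := by
    have hpos : 0 < b * p.2 := mul_pos hb (lt_of_le_of_ne hpy hp2.symm)
    nlinarith [key p rfl, mul_nonneg (mul_nonneg ha.le hpx) (sub_nonneg.2 hm1),
      mul_nonneg (show 0 ≤ a * b - a * p.1 - b * p.2 by linarith) hm0]
  have hM1 : M = b * α := by
    have hpos : 0 < a * q.1 := mul_pos ha (lt_of_le_of_ne hqx hq1.symm)
    nlinarith [key q hpq.symm, mul_nonneg (mul_nonneg hb.le hqy) (sub_nonneg.2 hm2),
      mul_nonneg (show 0 ≤ a * b - a * q.1 - b * q.2 by linarith) hm0]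
  have hM0 : M = 0 := by
    have hpos : 0 < a * b - a * r.1 - b * r.2 := by
      have := lt_of_le_of_ne hrs hr0
      linarith
    nlinarith [key r hpr.symm, mul_nonneg (mul_nonneg hb.le hry) (sub_nonneg.2 hm2),
      mul_nonneg (mul_nonneg ha.le hrx) (sub_nonneg.2 hm1)]
  have hα : α = 0 := by
    have : b * α = 0 := hM1 ▸ hM0
    exact (mul_eq_zero.1 this).resolve_left hb.ne'
  have hβ : β = 0 := by
    have : a * β = 0 := hM2 ▸ hM0
    exact (mul_eq_zero.1 this).resolve_left ha.ne'
  have hl0 : ∀ s, l s = 0 := fun s ↦ by rw [hl, hα, hβ]; simp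
  have hmem : ∀ s ∈ convexHull ℝ ({((0 : ℝ), (0 : ℝ)), (b, 0), (0, a)} : Set (ℝ × ℝ)),
      s ∈ {x ∈ convexHull ℝ ({((0 : ℝ), (0 : ℝ)), (b, 0), (0, a)} : Set (ℝ × ℝ)) |
        ∀ y ∈ convexHull ℝ ({((0 : ℝ), (0 : ℝ)), (b, 0), (0, a)} : Set (ℝ × ℝ)), l y ≤ l x} :=
    fun s hs ↦ ⟨hs, fun y _ ↦ by rw [hl0, hl0]⟩
  obtain ⟨v, hv⟩ := (collinear_iff_of_mem (hmem _ h0)).1 hcol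
  obtain ⟨s, hs⟩ := hv _ (hmem _ h1)
  obtain ⟨t, ht⟩ := hv _ (hmem _ h2)
  simp only [Prod.ext_iff, vadd_eq_add, Prod.fst_add, Prod.snd_add, Prod.smul_fst, Prod.smul_snd,
    smul_eq_mul, add_zero] at hs ht
  have hab : b * a = 0 := by
    rw [hs.1, ht.2]
    linear_combination (t * v.1) * hs.2.symm
  exact (mul_pos hb ha).ne' hab

/-- The edge of the triangle on the first coordinate axis. -/
lemma isFacet_triangle_snd {a b : ℝ} (ha : 0 < a) (hb : 0 < b) :
    IsFacet (convexHull ℝ ({((0 : ℝ), (0 : ℝ)), (b, 0), (0, a)} : Set (ℝ × ℝ)))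
      {p ∈ convexHull ℝ ({((0 : ℝ), (0 : ℝ)), (b, 0), (0, a)} : Set (ℝ × ℝ)) | p.2 = 0} := by
  have h0 := (mem_triangle_iff ha hb (0, 0)).2 (by simp [ha.le, hb.le, mul_nonneg])
  have h1 := (mem_triangle_iff ha hb (b, 0)).2 (by simp [hb.le])
  refine ⟨fun _ ↦ ⟨-ContinuousLinearMap.snd ℝ ℝ ℝ, ?_⟩, ?_, ?_⟩
  · ext p
    refine and_congr_right fun hp ↦ ⟨fun h q hq ↦ ?_, fun h ↦ ?_⟩
    · simpa [h] using ((mem_triangle_iff ha hb q).1 hq).2.1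
    · exact le_antisymm (by simpa using h _ h0) ((mem_triangle_iff ha hb p).1 hp).2.1
  · refine (collinear_iff_exists_forall_eq_smul_vadd _).2 ⟨(0, 0), (1, 0), ?_⟩
    rintro ⟨x, y⟩ ⟨-, rfl : y = 0⟩
    exact ⟨x, by simp⟩
  · intro h
    have heq : ((b, 0) : ℝ × ℝ) = (0, 0) := h ⟨h1, rfl⟩ ⟨h0, rfl⟩
    exact hb.ne' (congrArg Prod.fst heq)

/-- The edge of the triangle on the second coordinate axis. -/
lemma isFacet_triangle_fst {a b : ℝ} (ha : 0 < a) (hb : 0 < b) :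
    IsFacet (convexHull ℝ ({((0 : ℝ), (0 : ℝ)), (b, 0), (0, a)} : Set (ℝ × ℝ)))
      {p ∈ convexHull ℝ ({((0 : ℝ), (0 : ℝ)), (b, 0), (0, a)} : Set (ℝ × ℝ)) | p.1 = 0} := by
  have h0 := (mem_triangle_iff ha hb (0, 0)).2 (by simp [ha.le, hb.le, mul_nonneg])
  have h2 := (mem_triangle_iff ha hb (0, a)).2 (by simp [ha.le, mul_comm])
  refine ⟨fun _ ↦ ⟨-ContinuousLinearMap.fst ℝ ℝ ℝ, ?_⟩, ?_, ?_⟩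
  · ext p
    refine and_congr_right fun hp ↦ ⟨fun h q hq ↦ ?_, fun h ↦ ?_⟩
    · simpa [h] using ((mem_triangle_iff ha hb q).1 hq).1
    · exact le_antisymm (by simpa using h _ h0) ((mem_triangle_iff ha hb p).1 hp).1
  · refine (collinear_iff_exists_forall_eq_smul_vadd _).2 ⟨(0, 0), (0, 1), ?_⟩
    rintro ⟨x, y⟩ ⟨-, rfl : x = 0⟩
    exact ⟨y, by simp⟩
  · intro h
    have heq : ((0, a) : ℝ × ℝ) = (0, 0) := h ⟨h2, rfl⟩ ⟨h0, rfl⟩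
    exact ha.ne' (congrArg Prod.snd heq)

/-- If `a ≥ 2` does not divide `b`, some lattice point of the triangle on the line `y = 1` is off
the hypotenuse but leaves the triangle when moved by `(1, 0)`. -/
lemma exists_lattice_point_near_hypotenuse {a b : ℤ} (ha : 2 ≤ a) (hb : 0 < b)
    (hab : ¬ a ∣ b) : ∃ x : ℤ, 0 ≤ x ∧ a * x + b < a * b ∧ a * b < a * (x + 1) + b := by
  have hmod := Int.mul_ediv_add_emod (b * (a - 1)) a
  have hlt := Int.emod_lt_of_pos (b * (a - 1)) (show 0 < a by lia)
  have hnn := Int.emod_nonneg (b * (a - 1)) (show a ≠ 0 by lia)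
  have hne : b * (a - 1) % a ≠ 0 := fun h ↦ hab <| by
    have hdvd := Int.dvd_of_emod_eq_zero h
    rw [mul_sub, mul_one] at hdvd
    exact (dvd_sub_right (dvd_mul_left a b)).1 hdvd
  have hpos : 0 < b * (a - 1) % a := lt_of_le_of_ne hnn hne.symm
  refine ⟨b * (a - 1) / a, Int.ediv_nonneg (mul_nonneg hb.le (by lia)) (by lia), ?_, ?_⟩ <;>
    linarith

/-- No nonzero vector moves all lattice points off the hypotenuse into the triangle. -/
lemma eq_zero_of_hypotenuse_column {a b : ℤ} (ha : 3 ≤ a) (hb : 3 ≤ b) (hab : IsCoprime a b)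
    {v : ℤ × ℤ}
    (h : ∀ x y : ℤ, 0 ≤ x → 0 ≤ y → a * x + b * y < a * b →
      0 ≤ x + v.1 ∧ 0 ≤ y + v.2 ∧ a * (x + v.1) + b * (y + v.2) ≤ a * b) : v = 0 := by
  have hndvd : ∀ {c d : ℤ}, 3 ≤ c → IsCoprime c d → ¬ c ∣ d := fun hc hcd hdvd ↦ by
    have := Int.isUnit_iff.1 (hcd.isUnit_of_dvd' dvd_rfl hdvd)
    lia
  obtain ⟨m, n⟩ := v
  simp only at h
  obtain ⟨hm, hn, -⟩ := h 0 0 le_rfl le_rfl (by nlinarith)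
  have hx := (h (b - 1) 0 (by lia) le_rfl (by linarith)).2.2
  have hy := (h 0 (a - 1) le_rfl (by lia) (by linarith)).2.2
  have hm0 : m = 0 := by
    by_contra hne
    obtain ⟨x, hx0, hlt, hgt⟩ :=
      exists_lattice_point_near_hypotenuse (by lia) (by lia) (hndvd ha hab)
    have := (h x 1 hx0 zero_le_one (by linarith)).2.2
    have hm1 : 1 ≤ m := by lia
    nlinarith
  have hn0 : n = 0 := by
    by_contra hne
    obtain ⟨y, hy0, hlt, hgt⟩ :=
      exists_lattice_point_near_hypotenuse (a := b) (b := a) (by lia) (by lia)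
        (hndvd hb hab.symm)
    have := (h 1 y zero_le_one hy0 (by linarith)).2.2
    have hn1 : 1 ≤ n := by lia
    nlinarith
  rw [hm0, hn0]
  rfl

/-- A nonzero vector moving all lattice points off the axis `y = 0` into the triangle is
`(n, -1)` with `0 ≤ n ≤ b / a`. -/
lemma eq_of_axis_column {a b : ℕ} (ha : 0 < a) (hb : 0 < b) {m n : ℤ} (hv : (m, n) ≠ 0)
    (h : ∀ y : ℤ, 0 < y → y ≤ a → 0 ≤ m ∧ 0 ≤ y + n ∧ a * m + b * (y + n) ≤ (a * b : ℤ)) :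
    ∃ k : ℕ, k ≤ b / a ∧ m = k ∧ n = -1 := by
  obtain ⟨hm, -, hs⟩ := h a (by lia) le_rfl
  obtain ⟨-, hn, -⟩ := h 1 one_pos (by lia)
  have hs' : a * m + b * n ≤ (0 : ℤ) := by linarith
  have haz : (0 : ℤ) < a := by lia
  have hbz : (0 : ℤ) < b := by lia
  have hn1 : n = -1 := by
    by_contra hne
    have hn0 : 0 ≤ n := by lia
    have hm0 : m = 0 := by nlinarith [mul_nonneg hbz.le hn0]
    have hn0 : n = 0 := by nlinarith
    exact hv (by rw [hm0, hn0]; rfl)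
  lift m to ℕ using hm
  refine ⟨m, (Nat.le_div_iff_mul_le ha).2 ?_, rfl, hn1⟩
  subst hn1
  zify
  linarith

/-- The column vectors of the triangle. -/
lemma isColumnVector_triangle_iff {a b : ℕ} (ha : 3 ≤ a) (hb : 3 ≤ b) (hab : Nat.Coprime a b)
    (v : ℤ × ℤ) :
    IsColumnVector (convexHull ℝ
        ({((0 : ℝ), (0 : ℝ)), ((b : ℝ), 0), (0, (a : ℝ))} : Set (ℝ × ℝ))) v ↔
      (∃ n : ℕ, n ≤ b / a ∧ v = ((n : ℤ), -1)) ∨ ∃ m : ℕ, m ≤ a / b ∧ v = (-1, (m : ℤ)) := by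
  have ha0 : 0 < a := by lia
  have hb0 : 0 < b := by lia
  have haR : (0 : ℝ) < a := by exact_mod_cast ha0
  have hbR : (0 : ℝ) < b := by exact_mod_cast hb0
  have hmem := toR2_mem_triangle_iff ha0 hb0
  constructor
  · rintro ⟨hv, τ, hτ, hcol⟩
    rcases facet_triangle_cases haR hbR hτ with hline | hline | hline
    · left
      obtain ⟨k, hk, h1, h2⟩ := eq_of_axis_column ha0 hb0 (m := v.1) (n := v.2) hv
        fun y hy hya ↦ by
          have := (hmem _).1 <| hcol (0, y) ⟨(hmem _).2 ⟨le_rfl, hy.le, by dsimp only; nlinarith⟩,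
            fun hmemτ ↦ hy.ne' (by simpa [toR2] using hline _ hmemτ)⟩
          simpa using this
      exact ⟨k, hk, Prod.ext h1 h2⟩
    · right
      obtain ⟨k, hk, h1, h2⟩ := eq_of_axis_column hb0 ha0 (m := v.2) (n := v.1)
        (fun h ↦ hv (Prod.ext (congrArg Prod.snd h) (congrArg Prod.fst h)))
        fun x hx hxb ↦ by
          have := (hmem _).1 <| hcol (x, 0) ⟨(hmem _).2 ⟨hx.le, le_rfl, by dsimp only; nlinarith⟩,
            fun hmemτ ↦ hx.ne' (by simpa [toR2] using hline _ hmemτ)⟩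
          simp only [Prod.fst_add, Prod.snd_add, zero_add] at this
          exact ⟨this.2.1, this.1, by linarith [this.2.2]⟩
      exact ⟨k, hk, Prod.ext h2 h1⟩
    · refine absurd (eq_zero_of_hypotenuse_column (a := a) (b := b) (by lia) (by lia)
        (Nat.isCoprime_iff_coprime.2 hab) fun x y hx hy hxy ↦ ?_) hv
      refine (hmem _).1 <| hcol (x, y) ⟨(hmem _).2 ⟨hx, hy, hxy.le⟩, fun hmemτ ↦ hxy.ne ?_⟩
      have := hline _ hmemτ
      simp only [toR2] at this
      exact_mod_cast this
  · rintro (⟨n, hn, rfl⟩ | ⟨m, hm, rfl⟩)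
    · refine ⟨by simp [Prod.ext_iff], _, isFacet_triangle_snd haR hbR, fun p ⟨hp, hpτ⟩ ↦ ?_⟩
      have hp2 : p.2 ≠ 0 := fun h ↦ hpτ ⟨hp, by simp [toR2, h]⟩
      obtain ⟨hx, hy, hs⟩ := (hmem p).1 hp
      have hna : (n * a : ℤ) ≤ b := by exact_mod_cast (Nat.le_div_iff_mul_le ha0).1 hn
      refine (hmem _).2 ⟨?_, ?_, ?_⟩ <;> simp only [Prod.fst_add, Prod.snd_add]
      · lia
      · lia
      · linarith
    · refine ⟨by simp [Prod.ext_iff], _, isFacet_triangle_fst haR hbR, fun p ⟨hp, hpτ⟩ ↦ ?_⟩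
      have hp1 : p.1 ≠ 0 := fun h ↦ hpτ ⟨hp, by simp [toR2, h]⟩
      obtain ⟨hx, hy, hs⟩ := (hmem p).1 hp
      have hmb : (m * b : ℤ) ≤ a := by exact_mod_cast (Nat.le_div_iff_mul_le hb0).1 hm
      refine (hmem _).2 ⟨?_, ?_, ?_⟩ <;> simp only [Prod.fst_add, Prod.snd_add]
      · lia
      · lia
      · linarith

lemma ncard_column_families (k l : ℕ) :
    ({v : ℤ × ℤ | ∃ n : ℕ, n ≤ k ∧ v = ((n : ℤ), -1)} ∪
      {v : ℤ × ℤ | ∃ m : ℕ, m ≤ l ∧ v = (-1, (m : ℤ))}).ncard = k + l + 2 := by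
  have h1 : {v : ℤ × ℤ | ∃ n : ℕ, n ≤ k ∧ v = ((n : ℤ), -1)} =
      (fun n : ℕ ↦ ((n : ℤ), (-1 : ℤ))) '' Set.Iic k := by
    ext v
    simp [eq_comm]
  have h2 : {v : ℤ × ℤ | ∃ m : ℕ, m ≤ l ∧ v = (-1, (m : ℤ))} =
      (fun m : ℕ ↦ ((-1 : ℤ), (m : ℤ))) '' Set.Iic l := by
    ext v
    simp [eq_comm]
  rw [h1, h2, Set.ncard_union_eq ?_ ((Set.finite_Iic k).image _) ((Set.finite_Iic l).image _),
    Set.ncard_image_of_injective _ fun x y h ↦ by simpa using h,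
    Set.ncard_image_of_injective _ fun x y h ↦ by simpa using h]
  · simp only [Set.ncard_eq_toFinset_card', Set.toFinset_Iic, Nat.card_Iic]
    lia
  · rw [Set.disjoint_left]
    rintro _ ⟨n, -, rfl⟩ ⟨m, -, h⟩
    have := congrArg Prod.fst h
    simp only at this
    lia

/-- for coprime integers `a, b ≥ 3`, the set of column vectors of the
triangle `Δ = conv{(0,0),(b,0),(0,a)}` is exactly
`{(n,−1) : 0 ≤ n ≤ ⌊b/a⌋} ∪ {(−1,m) : 0 ≤ m ≤ ⌊a/b⌋}`; in particular
`c(Δ) = ⌊b/a⌋ + ⌊a/b⌋ + 2`. -/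
theorem columnVectors_of_triangle (a b : ℕ) (ha : 3 ≤ a) (hb : 3 ≤ b)
    (hab : Nat.Coprime a b) :
    {v : ℤ × ℤ | IsColumnVector (convexHull ℝ
        ({((0 : ℝ), (0 : ℝ)), ((b : ℝ), 0), (0, (a : ℝ))} : Set (ℝ × ℝ))) v} =
      ({v : ℤ × ℤ | ∃ n : ℕ, n ≤ b / a ∧ v = ((n : ℤ), -1)} ∪
       {v : ℤ × ℤ | ∃ m : ℕ, m ≤ a / b ∧ v = (-1, (m : ℤ))}) ∧
    colCount (convexHull ℝ
        ({((0 : ℝ), (0 : ℝ)), ((b : ℝ), 0), (0, (a : ℝ))} : Set (ℝ × ℝ))) =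
      b / a + a / b + 2 := by
  have hset := Set.ext (isColumnVector_triangle_iff ha hb hab)
  refine ⟨hset, ?_⟩
  rw [colCount]
  exact (congrArg Set.ncard hset).trans (ncard_column_families _ _)
end
end

section
/- For every integer g ≥ 2, the lattice polytope Δ = conv{(0,0),(2g+1,0),(0,2)} ⊂ ℝ² satisfies: #(Δ ∩ ℤ²) = 3g + 4, Δ has exactly g interior lattice points, and c(Δ) = g + 2; consequently #(Δ ∩ ℤ²) − c(Δ) − 3 = 2g − 1. -/
noncomputable section

theorem mem_convexHull_right_triangle {a b : ℝ} (ha : 0 < a) (hb : 0 < b) (p : ℝ × ℝ) :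
    p ∈ convexHull ℝ ({((0 : ℝ), (0 : ℝ)), (a, 0), (0, b)} : Set (ℝ × ℝ)) ↔
      0 ≤ p.1 ∧ 0 ≤ p.2 ∧ b * p.1 + a * p.2 ≤ a * b := by
  constructor
  · intro hp
    have hconv : Convex ℝ {p : ℝ × ℝ | 0 ≤ p.1 ∧ 0 ≤ p.2 ∧ b * p.1 + a * p.2 ≤ a * b} := by
      rintro ⟨x, y⟩ ⟨h1, h2, h3⟩ ⟨x', y'⟩ ⟨h1', h2', h3'⟩ s t hs ht hst
      dsimp only at *
      refine ⟨?_, ?_, ?_⟩ <;> simp only [Prod.smul_mk, Prod.mk_add_mk, smul_eq_mul]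
      · positivity
      · positivity
      · calc b * (s * x + t * x') + a * (s * y + t * y')
            = s * (b * x + a * y) + t * (b * x' + a * y') := by ring
          _ ≤ s * (a * b) + t * (a * b) := by gcongr
          _ = a * b := by rw [← add_mul, hst, one_mul]
    refine convexHull_min ?_ hconv hp
    rintro q (rfl | rfl | rfl) <;>
      simp only [Set.mem_ofPred_eq, mul_zero, add_zero, zero_add, le_refl, true_and]
    · positivity
    · exact ⟨ha.le, (mul_comm b a).le⟩
    · exact ⟨hb.le, trivial⟩
  · obtain ⟨x, y⟩ := p
    rintro ⟨h1, h2, h3⟩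
    dsimp only at h1 h2 h3
    have hsum := (convex_convexHull ℝ
      ({((0 : ℝ), (0 : ℝ)), (a, 0), (0, b)} : Set (ℝ × ℝ))).sum_mem
      (t := Finset.univ) (w := ![1 - x / a - y / b, x / a, y / b])
      (z := ![(0, 0), (a, 0), (0, b)]) ?_ ?_ ?_
    · simpa [Fin.sum_univ_three, ha.ne', hb.ne'] using hsum
    · have : x / a + y / b ≤ 1 := by
        rw [div_add_div _ _ ha.ne' hb.ne', div_le_one (by positivity)]
        linarith
      intro i _
      fin_cases i
      · change 0 ≤ 1 - x / a - y / b
        linarith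
      · exact div_nonneg h1 ha.le
      · exact div_nonneg h2 hb.le
    · simp only [Fin.sum_univ_three, Matrix.cons_val]
      ring
    · intro i _
      apply subset_convexHull
      fin_cases i <;> simp

theorem mem_interior_convexHull_right_triangle {a b : ℝ} (ha : 0 < a) (hb : 0 < b)
    (p : ℝ × ℝ) :
    p ∈ interior (convexHull ℝ ({((0 : ℝ), (0 : ℝ)), (a, 0), (0, b)} : Set (ℝ × ℝ))) ↔
      0 < p.1 ∧ 0 < p.2 ∧ b * p.1 + a * p.2 < a * b := by
  constructor
  · intro hp
    obtain ⟨ε, hε, hball⟩ := Metric.mem_nhds_iff.1 (mem_interior_iff_mem_nhds.1 hp)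
    have hmem (t : ℝ) (ht : |t| < ε) : (p.1 + t, p.2 + t) ∈ Metric.ball p ε := by
      simpa [Metric.mem_ball, Prod.dist_eq, Real.dist_eq] using ht
    have hlow := (mem_convexHull_right_triangle ha hb _).1
      (hball (hmem (-(ε / 2)) (by rw [abs_neg, abs_of_pos] <;> linarith)))
    have hhigh := (mem_convexHull_right_triangle ha hb _).1
      (hball (hmem (ε / 2) (by rw [abs_of_pos] <;> linarith)))
    dsimp only at hlow hhigh
    refine ⟨by linarith [hlow.1], by linarith [hlow.2.1], ?_⟩
    nlinarith [hhigh.2.2, mul_pos ha hε, mul_pos hb hε]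
  · intro hp
    refine interior_maximal
      (s := convexHull ℝ ({((0 : ℝ), (0 : ℝ)), (a, 0), (0, b)} : Set (ℝ × ℝ)))
      (t := {p : ℝ × ℝ | 0 < p.1 ∧ 0 < p.2 ∧ b * p.1 + a * p.2 < a * b}) ?_ ?_ hp
    · rintro q ⟨h1, h2, h3⟩
      exact (mem_convexHull_right_triangle ha hb q).2 ⟨h1.le, h2.le, h3.le⟩
    · exact (isOpen_lt continuous_const continuous_fst).inter
        ((isOpen_lt continuous_const continuous_snd).inter
          (isOpen_lt (f := fun p : ℝ × ℝ => b * p.1 + a * p.2) (by fun_prop) continuous_const))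

/-- A facet of a right triangle is contained in one of its three sides. -/
theorem IsFacet.subset_side_right_triangle {a b : ℝ} (ha : 0 < a) (hb : 0 < b)
    {τ : Set (ℝ × ℝ)}
    (hτ : IsFacet (convexHull ℝ ({((0 : ℝ), (0 : ℝ)), (a, 0), (0, b)} : Set (ℝ × ℝ))) τ) :
    (∀ p ∈ τ, p.1 = 0) ∨ (∀ p ∈ τ, p.2 = 0) ∨ ∀ p ∈ τ, b * p.1 + a * p.2 = a * b := by
  obtain ⟨hexp, hcol, hsub⟩ := hτ
  obtain ⟨l, hl⟩ := hexp (Set.not_subsingleton_iff.1 hsub).nonempty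
  have hlin (x y : ℝ) : l (x, y) = x * l (1, 0) + y * l (0, 1) := by
    rw [← smul_eq_mul, ← smul_eq_mul, ← map_smul, ← map_smul, ← map_add]
    simp
  have hO := (mem_convexHull_right_triangle ha hb (0, 0)).2
    ⟨le_rfl, le_rfl, by simpa using (mul_pos ha hb).le⟩
  have hA := (mem_convexHull_right_triangle ha hb (a, 0)).2
    ⟨ha.le, le_rfl, by simp [mul_comm]⟩
  have hB := (mem_convexHull_right_triangle ha hb (0, b)).2 ⟨le_rfl, hb.le, by simp⟩
  have hab : 0 < a * b := mul_pos ha hb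
  have hkey : ∀ p ∈ τ, p.1 * (l p - l (a, 0)) = 0 ∧ p.2 * (l p - l (0, b)) = 0 ∧
      (a * b - (b * p.1 + a * p.2)) * l p = 0 := by
    rintro ⟨x, y⟩ hp
    rw [hl] at hp
    obtain ⟨hm, hmax⟩ := hp
    obtain ⟨hx, hy, hxy⟩ := (mem_convexHull_right_triangle ha hb _).1 hm
    have hnonneg : 0 ≤ l (x, y) := by simpa [hlin 0 0] using hmax _ hO
    have hxA := mul_nonneg hx (sub_nonneg.2 (hmax _ hA))
    have hyB := mul_nonneg hy (sub_nonneg.2 (hmax _ hB))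
    have hxyO := mul_nonneg (sub_nonneg.2 hxy) hnonneg
    have hsum : b * (x * (l (x, y) - l (a, 0))) + a * (y * (l (x, y) - l (0, b))) +
        (a * b - (b * x + a * y)) * l (x, y) = 0 := by
      rw [hlin x y, hlin a 0, hlin 0 b]
      ring
    have hbA := mul_nonneg hb.le hxA
    have haB := mul_nonneg ha.le hyB
    dsimp only at hxA hyB hxyO hbA haB ⊢
    refine ⟨?_, ?_, by linarith⟩
    · exact (mul_eq_zero.1 (show b * (x * (l (x, y) - l (a, 0))) = 0 by linarith)).resolve_left
        hb.ne'
    · exact (mul_eq_zero.1 (show a * (y * (l (x, y) - l (0, b))) = 0 by linarith)).resolve_left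
        ha.ne'
  have hmem {p q : ℝ × ℝ} (hp : p ∈ τ)
      (hq : q ∈ convexHull ℝ ({((0 : ℝ), (0 : ℝ)), (a, 0), (0, b)} : Set (ℝ × ℝ)))
      (h : l p = l q) : q ∈ τ := by
    rw [hl] at hp ⊢
    exact ⟨hq, fun r hr => h ▸ hp.2 r hr⟩
  by_contra! hcon
  obtain ⟨⟨p, hp, hp1⟩, ⟨q, hq, hq2⟩, ⟨r, hr, hr3⟩⟩ := hcon
  have hAτ := hmem hp hA (sub_eq_zero.1 ((mul_eq_zero.1 (hkey p hp).1).resolve_left hp1))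
  have hBτ := hmem hq hB (sub_eq_zero.1 ((mul_eq_zero.1 (hkey q hq).2.1).resolve_left hq2))
  have hOτ := hmem hr hO (by
    rw [(mul_eq_zero.1 (hkey r hr).2.2).resolve_left (sub_ne_zero.2 hr3.symm), hlin 0 0]
    simp)
  obtain ⟨⟨d, e⟩, hv⟩ := (collinear_iff_of_mem hOτ).1 hcol
  obtain ⟨s, hs⟩ := hv _ hAτ
  obtain ⟨t, ht⟩ := hv _ hBτ
  simp only [vadd_eq_add, Prod.smul_mk, Prod.mk_add_mk, smul_eq_mul, add_zero,
    Prod.mk.injEq] at hs ht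
  have : a * b = 0 := by
    rw [hs.1, ht.2]
    linear_combination (-(t * d)) * hs.2
  exact hab.ne' this

theorem isFacet_left_side_right_triangle {a b : ℝ} (ha : 0 < a) (hb : 0 < b) :
    IsFacet (convexHull ℝ ({((0 : ℝ), (0 : ℝ)), (a, 0), (0, b)} : Set (ℝ × ℝ)))
      {p | p ∈ convexHull ℝ ({((0 : ℝ), (0 : ℝ)), (a, 0), (0, b)} : Set (ℝ × ℝ)) ∧
        p.1 = 0} := by
  have hO : ((0 : ℝ), (0 : ℝ)) ∈ convexHull ℝ
    ({((0 : ℝ), (0 : ℝ)), (a, 0), (0, b)} : Set (ℝ × ℝ)) := subset_convexHull ℝ _ (by simp)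
  have hB : ((0 : ℝ), b) ∈ convexHull ℝ
    ({((0 : ℝ), (0 : ℝ)), (a, 0), (0, b)} : Set (ℝ × ℝ)) := subset_convexHull ℝ _ (by simp)
  refine ⟨fun _ => ⟨-ContinuousLinearMap.fst ℝ ℝ ℝ, ?_⟩, ?_, ?_⟩
  · ext p
    refine and_congr_right fun hp => ⟨fun h q hq => ?_, fun h => ?_⟩
    · simpa [h] using ((mem_convexHull_right_triangle ha hb q).1 hq).1
    · have := h _ hO
      simp only [neg_apply, ContinuousLinearMap.coe_fst', neg_zero] at this
      linarith [((mem_convexHull_right_triangle ha hb p).1 hp).1]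
  · refine (collinear_iff_of_mem (p₀ := (0, 0)) (by exact ⟨hO, rfl⟩)).2 ⟨(0, 1), ?_⟩
    rintro ⟨x, y⟩ ⟨-, hx⟩
    exact ⟨y, by simpa using hx⟩
  · intro h
    have := h ⟨hO, rfl⟩ ⟨hB, rfl⟩
    simp [hb.ne] at this

theorem isFacet_bottom_side_right_triangle {a b : ℝ} (ha : 0 < a) (hb : 0 < b) :
    IsFacet (convexHull ℝ ({((0 : ℝ), (0 : ℝ)), (a, 0), (0, b)} : Set (ℝ × ℝ)))
      {p | p ∈ convexHull ℝ ({((0 : ℝ), (0 : ℝ)), (a, 0), (0, b)} : Set (ℝ × ℝ)) ∧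
        p.2 = 0} := by
  have hO : ((0 : ℝ), (0 : ℝ)) ∈ convexHull ℝ
    ({((0 : ℝ), (0 : ℝ)), (a, 0), (0, b)} : Set (ℝ × ℝ)) := subset_convexHull ℝ _ (by simp)
  have hA : (a, (0 : ℝ)) ∈ convexHull ℝ
    ({((0 : ℝ), (0 : ℝ)), (a, 0), (0, b)} : Set (ℝ × ℝ)) := subset_convexHull ℝ _ (by simp)
  refine ⟨fun _ => ⟨-ContinuousLinearMap.snd ℝ ℝ ℝ, ?_⟩, ?_, ?_⟩
  · ext p
    refine and_congr_right fun hp => ⟨fun h q hq => ?_, fun h => ?_⟩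
    · simpa [h] using ((mem_convexHull_right_triangle ha hb q).1 hq).2.1
    · have := h _ hO
      simp only [neg_apply, ContinuousLinearMap.coe_snd', neg_zero] at this
      linarith [((mem_convexHull_right_triangle ha hb p).1 hp).2.1]
  · refine (collinear_iff_of_mem (p₀ := (0, 0)) (by exact ⟨hO, rfl⟩)).2 ⟨(1, 0), ?_⟩
    rintro ⟨x, y⟩ ⟨-, hy⟩
    exact ⟨x, by simpa using hy⟩
  · intro h
    have := h ⟨hO, rfl⟩ ⟨hA, rfl⟩
    simp [ha.ne] at this

/-- The triangle with vertices `(0,0)`, `(2g+1,0)` and `(0,2)`. -/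
abbrev hyperellipticTriangle (g : ℕ) : Set (ℝ × ℝ) :=
  convexHull ℝ ({((0 : ℝ), (0 : ℝ)), (((2 * g + 1 : ℕ) : ℝ), 0), (0, 2)} : Set (ℝ × ℝ))

theorem toR2_mem_hyperellipticTriangle {g : ℕ} {x y : ℤ} :
    toR2 (x, y) ∈ hyperellipticTriangle g ↔
      (0 ≤ x ∧ x ≤ 2 * g + 1 ∧ y = 0) ∨ (0 ≤ x ∧ x ≤ g ∧ y = 1) ∨ (x = 0 ∧ y = 2) := by
  rw [mem_convexHull_right_triangle (by positivity) two_pos]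
  have hcast : (0 ≤ (x : ℝ) ∧ 0 ≤ (y : ℝ) ∧
      2 * (x : ℝ) + ((2 * g + 1 : ℕ) : ℝ) * y ≤ ((2 * g + 1 : ℕ) : ℝ) * 2) ↔
      (0 ≤ x ∧ 0 ≤ y ∧ 2 * x + (2 * g + 1) * y ≤ (2 * g + 1) * 2) := by
    norm_cast
  refine hcast.trans ⟨fun ⟨hx, hy, hxy⟩ => ?_, ?_⟩
  · have hy2 : y ≤ 2 := by nlinarith [Int.natCast_nonneg g]
    interval_cases y <;> omega
  · rintro (⟨h1, h2, rfl⟩ | ⟨h1, h2, rfl⟩ | ⟨rfl, rfl⟩) <;> omega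

theorem toR2_mem_interior_hyperellipticTriangle {g : ℕ} {x y : ℤ} :
    toR2 (x, y) ∈ interior (hyperellipticTriangle g) ↔ 1 ≤ x ∧ x ≤ g ∧ y = 1 := by
  rw [mem_interior_convexHull_right_triangle (by positivity) two_pos]
  have hcast : (0 < (x : ℝ) ∧ 0 < (y : ℝ) ∧
      2 * (x : ℝ) + ((2 * g + 1 : ℕ) : ℝ) * y < ((2 * g + 1 : ℕ) : ℝ) * 2) ↔
      (0 < x ∧ 0 < y ∧ 2 * x + (2 * g + 1) * y < (2 * g + 1) * 2) := by
    norm_cast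
  refine hcast.trans ⟨fun ⟨hx, hy, hxy⟩ => ?_, ?_⟩
  · have hy2 : y < 2 := by nlinarith [Int.natCast_nonneg g]
    interval_cases y
    omega
  · rintro ⟨h1, h2, rfl⟩
    omega

theorem isColumnVector_hyperellipticTriangle {g : ℕ} (hg : 2 ≤ g) {c d : ℤ} :
    IsColumnVector (hyperellipticTriangle g) (c, d) ↔
      (0 ≤ c ∧ c ≤ g ∧ d = -1) ∨ (c = -1 ∧ d = 0) := by
  have hN : (0 : ℝ) < ((2 * g + 1 : ℕ) : ℝ) := by positivity
  constructor
  · rintro ⟨hne, τ, hτ, hshift⟩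
    have hne' : ¬ (c = 0 ∧ d = 0) := by simpa using hne
    have hmove (x y : ℤ) (hxy : toR2 (x, y) ∈ hyperellipticTriangle g)
        (hnot : toR2 (x, y) ∉ τ) :=
      toR2_mem_hyperellipticTriangle.1 (hshift (x, y) ⟨hxy, hnot⟩)
    rcases hτ.subset_side_right_triangle hN two_pos with h | h | h
    · have hnot (x y : ℤ) (hx : 1 ≤ x) : toR2 (x, y) ∉ τ := fun hmem => by
        have : (x : ℝ) = 0 := h _ hmem
        norm_cast at this
        omega
      have h1 := hmove 1 0 (toR2_mem_hyperellipticTriangle.2 (by omega)) (hnot _ _ le_rfl)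
      have h2 := hmove (2 * g + 1) 0 (toR2_mem_hyperellipticTriangle.2 (by omega))
        (hnot _ _ (by omega))
      omega
    · have hnot (x y : ℤ) (hy : 1 ≤ y) : toR2 (x, y) ∉ τ := fun hmem => by
        have : (y : ℝ) = 0 := h _ hmem
        norm_cast at this
        omega
      have h1 := hmove 0 1 (toR2_mem_hyperellipticTriangle.2 (by omega)) (hnot _ _ le_rfl)
      have h2 := hmove 0 2 (toR2_mem_hyperellipticTriangle.2 (by omega))
        (hnot _ _ (by omega))
      omega
    · have hnot (x y : ℤ) (hxy : 2 * x + (2 * g + 1) * y < (2 * g + 1) * 2) :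
          toR2 (x, y) ∉ τ := fun hmem => by
        have : 2 * (x : ℝ) + ((2 * g + 1 : ℕ) : ℝ) * y = ((2 * g + 1 : ℕ) : ℝ) * 2 := h _ hmem
        norm_cast at this
        push_cast at this
        omega
      have h1 := hmove 0 0 (toR2_mem_hyperellipticTriangle.2 (by omega)) (hnot _ _ (by omega))
      have h2 := hmove (2 * g) 0 (toR2_mem_hyperellipticTriangle.2 (by omega))
        (hnot _ _ (by omega))
      have h3 := hmove g 1 (toR2_mem_hyperellipticTriangle.2 (by omega)) (hnot _ _ (by omega))
      omega
  · rintro (⟨h0, hcg, rfl⟩ | ⟨rfl, rfl⟩)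
    · refine ⟨by simp, _, isFacet_bottom_side_right_triangle hN two_pos, ?_⟩
      rintro ⟨x, y⟩ ⟨hmem, hnot⟩
      have hy : y ≠ 0 := by
        rintro rfl
        exact hnot ⟨hmem, Int.cast_zero⟩
      have := toR2_mem_hyperellipticTriangle.1 hmem
      exact toR2_mem_hyperellipticTriangle.2 (by omega)
    · refine ⟨by simp, _, isFacet_left_side_right_triangle hN two_pos, ?_⟩
      rintro ⟨x, y⟩ ⟨hmem, hnot⟩
      have hx : x ≠ 0 := by
        rintro rfl
        exact hnot ⟨hmem, Int.cast_zero⟩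
      have := toR2_mem_hyperellipticTriangle.1 hmem
      exact toR2_mem_hyperellipticTriangle.2 (by omega)

theorem ncard_latticePts_hyperellipticTriangle (g : ℕ) :
    (latticePts (hyperellipticTriangle g)).ncard = 3 * g + 4 := by
  have h : latticePts (hyperellipticTriangle g) =
      ((Finset.Icc (0 : ℤ) (2 * g + 1) ×ˢ {0} ∪
        (Finset.Icc (0 : ℤ) g ×ˢ {1} ∪ {((0 : ℤ), (2 : ℤ))}) : Finset (ℤ × ℤ)) :
          Set (ℤ × ℤ)) := by
    ext ⟨x, y⟩
    refine toR2_mem_hyperellipticTriangle.trans ?_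
    simp only [Finset.coe_union, Finset.coe_product, Finset.coe_Icc, Finset.coe_singleton,
      Set.mem_union, Set.mem_prod, Set.mem_Icc, Set.mem_singleton_iff, Prod.mk.injEq, and_assoc]
  rw [h, Set.ncard_coe_finset, Finset.card_union_of_disjoint, Finset.card_union_of_disjoint]
  · simp only [Finset.card_product, Int.card_Icc, Finset.card_singleton]
    omega
  · rw [Finset.disjoint_left]
    rintro ⟨x, y⟩ h1 h2
    simp at h1 h2
    omega
  · rw [Finset.disjoint_left]
    rintro ⟨x, y⟩ h1 h2
    simp at h1 h2
    omega

theorem ncard_intPts_hyperellipticTriangle (g : ℕ) :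
    (intPts (hyperellipticTriangle g)).ncard = g := by
  have h : intPts (hyperellipticTriangle g) =
      ((Finset.Icc (1 : ℤ) g ×ˢ {1} : Finset (ℤ × ℤ)) : Set (ℤ × ℤ)) := by
    ext ⟨x, y⟩
    refine toR2_mem_interior_hyperellipticTriangle.trans ?_
    simp only [Finset.coe_product, Finset.coe_Icc, Finset.coe_singleton, Set.mem_prod,
      Set.mem_Icc, Set.mem_singleton_iff, and_assoc]
  rw [h, Set.ncard_coe_finset]
  simp

theorem colCount_hyperellipticTriangle {g : ℕ} (hg : 2 ≤ g) :
    colCount (hyperellipticTriangle g) = g + 2 := by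
  have h : {v | IsColumnVector (hyperellipticTriangle g) v} =
      ((Finset.Icc (0 : ℤ) g ×ˢ {-1} ∪ {((-1 : ℤ), (0 : ℤ))} : Finset (ℤ × ℤ)) :
        Set (ℤ × ℤ)) := by
    ext ⟨c, d⟩
    refine (isColumnVector_hyperellipticTriangle hg).trans ?_
    simp only [Finset.coe_union, Finset.coe_product, Finset.coe_Icc, Finset.coe_singleton,
      Set.mem_union, Set.mem_prod, Set.mem_Icc, Set.mem_singleton_iff, Prod.mk.injEq, and_assoc]
  rw [colCount, h, Set.ncard_coe_finset, Finset.card_union_of_disjoint]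
  · simp only [Finset.card_product, Int.card_Icc, Finset.card_singleton]
    omega
  · rw [Finset.disjoint_left]
    rintro ⟨x, y⟩ h1 h2
    simp at h1 h2
    omega

/-- for every integer `g ≥ 2`, the triangle
`Δ = conv{(0,0),(2g+1,0),(0,2)}` has `3g+4` lattice points, exactly `g` interior
lattice points and `c(Δ) = g+2`; consequently `#(Δ ∩ ℤ²) − c(Δ) − 3 = 2g − 1`. -/
theorem hyperelliptic_triangle_counts (g : ℕ) (hg : 2 ≤ g) :
    (latticePts (convexHull ℝ
        ({((0 : ℝ), (0 : ℝ)), (((2 * g + 1 : ℕ) : ℝ), 0), (0, 2)} : Set (ℝ × ℝ)))).ncard =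
      3 * g + 4 ∧
    (intPts (convexHull ℝ
        ({((0 : ℝ), (0 : ℝ)), (((2 * g + 1 : ℕ) : ℝ), 0), (0, 2)} : Set (ℝ × ℝ)))).ncard = g ∧
    colCount (convexHull ℝ
        ({((0 : ℝ), (0 : ℝ)), (((2 * g + 1 : ℕ) : ℝ), 0), (0, 2)} : Set (ℝ × ℝ))) =
      g + 2 ∧
    ((latticePts (convexHull ℝ
        ({((0 : ℝ), (0 : ℝ)), (((2 * g + 1 : ℕ) : ℝ), 0), (0, 2)} : Set (ℝ × ℝ)))).ncard : ℤ) -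
      (colCount (convexHull ℝ
        ({((0 : ℝ), (0 : ℝ)), (((2 * g + 1 : ℕ) : ℝ), 0), (0, 2)} : Set (ℝ × ℝ))) : ℤ) - 3 =
      2 * (g : ℤ) - 1 := by
  have hpts := ncard_latticePts_hyperellipticTriangle g
  have hcol := colCount_hyperellipticTriangle hg
  refine ⟨hpts, ncard_intPts_hyperellipticTriangle g, hcol, ?_⟩
  rw [hpts, hcol]
  push_cast
  ring
end
end

section
/- For every integer h ≥ 2, the trapezoidal lattice polytope Δ = conv{(0,0),(0,3),(h,3),(h+3,0)} ⊂ ℝ² satisfies: #(Δ ∩ ℤ²) = 4h + 10, Δ has exactly 2h + 1 interior lattice points, c(Δ) = 4, and Δ is maximal. -/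
noncomputable section

/-- The trapezium with vertices `(0,0)`, `(0,3)`, `(h,3)`, `(h+3,0)`, cut out by its four
edge inequalities. -/
def trapezium (h : ℕ) : Set (ℝ × ℝ) :=
  {p | 0 ≤ p.1 ∧ 0 ≤ p.2 ∧ p.2 ≤ 3 ∧ p.1 + p.2 ≤ h + 3}

theorem mem_trapezium {h : ℕ} {p : ℝ × ℝ} :
    p ∈ trapezium h ↔ 0 ≤ p.1 ∧ 0 ≤ p.2 ∧ p.2 ≤ 3 ∧ p.1 + p.2 ≤ h + 3 := Iff.rfl

theorem convex_trapezium (h : ℕ) : Convex ℝ (trapezium h) := by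
  rintro ⟨x, y⟩ ⟨h1, h2, h3, h4⟩ ⟨x', y'⟩ ⟨k1, k2, k3, k4⟩ a b ha hb hab
  obtain rfl : b = 1 - a := by linarith
  simp only [mem_trapezium, Prod.smul_mk, Prod.mk_add_mk, smul_eq_mul] at *
  refine ⟨by positivity, by positivity, ?_, ?_⟩ <;> nlinarith

theorem convexHull_vertices_eq_trapezium (h : ℕ) :
    convexHull ℝ ({((0 : ℝ), (0 : ℝ)), (0, 3), (((h : ℕ) : ℝ), 3), (((h + 3 : ℕ) : ℝ), 0)} :
      Set (ℝ × ℝ)) = trapezium h := by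
  have hn : (0 : ℝ) ≤ h := h.cast_nonneg
  apply Set.Subset.antisymm
  · apply convexHull_min _ (convex_trapezium h)
    rintro p (rfl | rfl | rfl | rfl) <;> simp only [mem_trapezium] <;> push_cast <;>
      refine ⟨?_, ?_, ?_, ?_⟩ <;> linarith
  · rintro ⟨x, y⟩ ⟨h1, h2, h3, h4⟩
    simp only at h1 h2 h3 h4
    set V : Set (ℝ × ℝ) :=
      {((0 : ℝ), (0 : ℝ)), (0, 3), (((h : ℕ) : ℝ), 3), (((h + 3 : ℕ) : ℝ), 0)} with hV
    have hc := convex_convexHull ℝ V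
    have left : ((0 : ℝ), y) ∈ convexHull ℝ V := by
      have := hc (subset_convexHull ℝ V (show ((0 : ℝ), (0 : ℝ)) ∈ V by simp [hV]))
        (subset_convexHull ℝ V (show ((0 : ℝ), (3 : ℝ)) ∈ V by simp [hV]))
        (show 0 ≤ 1 - y / 3 by linarith) (show 0 ≤ y / 3 by linarith) (by ring)
      convert this using 1
      ext <;> simp
    have right : ((h + 3 - y : ℝ), y) ∈ convexHull ℝ V := by
      have := hc (subset_convexHull ℝ V (show (((h + 3 : ℕ) : ℝ), (0 : ℝ)) ∈ V by simp [hV]))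
        (subset_convexHull ℝ V (show ((h : ℝ), (3 : ℝ)) ∈ V by simp [hV]))
        (show 0 ≤ 1 - y / 3 by linarith) (show 0 ≤ y / 3 by linarith) (by ring)
      convert this using 1
      ext
      · simp; ring
      · simp
    rcases eq_or_lt_of_le h1 with rfl | hx
    · exact left
    have hd : 0 < h + 3 - y := by linarith
    have hq : x / (h + 3 - y) ≤ 1 := by rw [div_le_one hd]; linarith
    have := hc left right (sub_nonneg.2 hq)
      (show 0 ≤ x / (h + 3 - y) by positivity) (by ring)
    convert this using 1
    ext
    · simp [hd.ne']
    · simp; ring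

theorem isOpenMap_of_apply_ne_zero {l : ℝ × ℝ →L[ℝ] ℝ} {v : ℝ × ℝ} (hv : l v ≠ 0) :
    IsOpenMap l := by
  apply l.isOpenMap
  intro c
  exact ⟨(c / l v) • v, by simp [hv]⟩

theorem ContinuousLinearMap.lt_of_mem_interior {l : ℝ × ℝ →L[ℝ] ℝ} {v : ℝ × ℝ}
    (hv : l v ≠ 0) {s : Set (ℝ × ℝ)} {c : ℝ} (hs : ∀ p ∈ s, l p ≤ c) {p : ℝ × ℝ}
    (hp : p ∈ interior s) : l p < c := by
  have hopen := isOpenMap_of_apply_ne_zero hv _ (isOpen_interior (s := s))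
  have hsub : l '' interior s ⊆ Set.Iic c := by
    rintro _ ⟨q, hq, rfl⟩
    exact hs q (interior_subset hq)
  have := interior_maximal hsub hopen ⟨p, hp, rfl⟩
  rwa [interior_Iic] at this

theorem mem_interior_trapezium {h : ℕ} {p : ℝ × ℝ} :
    p ∈ interior (trapezium h) ↔ 0 < p.1 ∧ 0 < p.2 ∧ p.2 < 3 ∧ p.1 + p.2 < h + 3 := by
  constructor
  · intro hp
    refine ⟨?_, ?_, ?_, ?_⟩
    · have := ContinuousLinearMap.lt_of_mem_interior
        (l := -ContinuousLinearMap.fst ℝ ℝ ℝ) (v := (1, 0)) (c := 0) (by simp)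
        (fun q hq => by simpa using hq.1) hp
      simpa using this
    · have := ContinuousLinearMap.lt_of_mem_interior
        (l := -ContinuousLinearMap.snd ℝ ℝ ℝ) (v := (0, 1)) (c := 0) (by simp)
        (fun q hq => by simpa using hq.2.1) hp
      simpa using this
    · exact ContinuousLinearMap.lt_of_mem_interior
        (l := ContinuousLinearMap.snd ℝ ℝ ℝ) (v := (0, 1)) (by simp)
        (fun q hq => hq.2.2.1) hp
    · exact ContinuousLinearMap.lt_of_mem_interior
        (l := ContinuousLinearMap.fst ℝ ℝ ℝ + ContinuousLinearMap.snd ℝ ℝ ℝ) (v := (0, 1))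
        (by simp) (fun q hq => hq.2.2.2) hp
  · intro hp
    have hopen : IsOpen {p : ℝ × ℝ | 0 < p.1 ∧ 0 < p.2 ∧ p.2 < 3 ∧ p.1 + p.2 < h + 3} :=
      (isOpen_lt continuous_const continuous_fst).inter
        ((isOpen_lt continuous_const continuous_snd).inter
          ((isOpen_lt continuous_snd continuous_const).inter
            (isOpen_lt (continuous_fst.add continuous_snd) continuous_const)))
    refine interior_maximal ?_ hopen hp
    exact fun q hq => ⟨hq.1.le, hq.2.1.le, hq.2.2.1.le, hq.2.2.2.le⟩

theorem toR2_mem_trapezium {h : ℕ} {p : ℤ × ℤ} :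
    toR2 p ∈ trapezium h ↔ 0 ≤ p.1 ∧ 0 ≤ p.2 ∧ p.2 ≤ 3 ∧ p.1 + p.2 ≤ h + 3 := by
  simp only [mem_trapezium, toR2]
  norm_cast

theorem mem_intPts_trapezium {h : ℕ} {p : ℤ × ℤ} :
    p ∈ intPts (trapezium h) ↔ 0 < p.1 ∧ 0 < p.2 ∧ p.2 < 3 ∧ p.1 + p.2 < h + 3 := by
  simp only [intPts, Set.mem_ofPred_eq, mem_interior_trapezium, toR2]
  norm_cast

theorem ncard_integer_rows (a b c d : ℤ) :
    {p : ℤ × ℤ | (a ≤ p.2 ∧ p.2 ≤ b) ∧ c ≤ p.1 ∧ p.1 ≤ d - p.2}.ncard =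
      ∑ y ∈ Finset.Icc a b, (d - y + 1 - c).toNat := by
  have hinj : Function.Injective (fun q : (_ : ℤ) × ℤ => (q.2, q.1)) := by
    rintro ⟨y, x⟩ ⟨y', x'⟩ hq
    simp only [Prod.mk.injEq] at hq
    obtain ⟨rfl, rfl⟩ := hq
    rfl
  have himage : {p : ℤ × ℤ | (a ≤ p.2 ∧ p.2 ≤ b) ∧ c ≤ p.1 ∧ p.1 ≤ d - p.2} =
      (fun q : (_ : ℤ) × ℤ => (q.2, q.1)) ''
        ((Finset.Icc a b).sigma fun y => Finset.Icc c (d - y) : Finset ((_ : ℤ) × ℤ)) := by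
    ext ⟨x, y⟩
    constructor
    · intro hp
      exact ⟨⟨y, x⟩, by simpa using hp, rfl⟩
    · rintro ⟨⟨y', x'⟩, hq, hxy⟩
      simp only [Prod.mk.injEq] at hxy
      obtain ⟨rfl, rfl⟩ := hxy
      simpa using hq
  rw [himage, Set.ncard_image_of_injective _ hinj, Set.ncard_coe_finset, Finset.card_sigma]
  simp

theorem ncard_latticePts_trapezium (h : ℕ) : (latticePts (trapezium h)).ncard = 4 * h + 10 := by
  have heq : latticePts (trapezium h) =
      {p : ℤ × ℤ | (0 ≤ p.2 ∧ p.2 ≤ 3) ∧ 0 ≤ p.1 ∧ p.1 ≤ (h + 3 : ℤ) - p.2} := by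
    ext p
    simp only [latticePts, Set.mem_ofPred_eq, toR2_mem_trapezium]
    omega
  have hrows : Finset.Icc (0 : ℤ) 3 = {0, 1, 2, 3} := by decide
  rw [heq, ncard_integer_rows, hrows]
  simp
  omega

theorem ncard_intPts_trapezium (h : ℕ) : (intPts (trapezium h)).ncard = 2 * h + 1 := by
  have heq : intPts (trapezium h) =
      {p : ℤ × ℤ | (1 ≤ p.2 ∧ p.2 ≤ 2) ∧ 1 ≤ p.1 ∧ p.1 ≤ (h + 2 : ℤ) - p.2} := by
    ext p
    simp only [mem_intPts_trapezium, Set.mem_ofPred_eq]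
    omega
  have hrows : Finset.Icc (1 : ℤ) 2 = {1, 2} := by decide
  rw [heq, ncard_integer_rows, hrows]
  simp
  omega

theorem ContinuousLinearMap.apply_eq_coordinates (l : ℝ × ℝ →L[ℝ] ℝ) (p : ℝ × ℝ) :
    l p = p.1 * l (1, 0) + p.2 * l (0, 1) := by
  rw [← smul_eq_mul, ← smul_eq_mul, ← map_smul, ← map_smul, ← map_add]
  congr 1
  ext <;> simp

theorem not_collinear_trapezium (h : ℕ) : ¬ Collinear ℝ (trapezium h) := by
  intro hcol
  have hn : (0 : ℝ) ≤ h := h.cast_nonneg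
  have h0 : ((0 : ℝ), (0 : ℝ)) ∈ trapezium h := by
    refine ⟨?_, ?_, ?_, ?_⟩ <;> simp; linarith
  obtain ⟨v, hv⟩ := (collinear_iff_of_mem h0).1 hcol
  obtain ⟨r, hr⟩ := hv (1, 0) (by refine ⟨?_, ?_, ?_, ?_⟩ <;> simp; linarith)
  obtain ⟨s, hs⟩ := hv (0, 1) (by refine ⟨?_, ?_, ?_, ?_⟩ <;> simp; linarith)
  simp [Prod.ext_iff] at hr hs
  obtain ⟨hr1, hr2⟩ := hr
  obtain ⟨hs1, hs2⟩ := hs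
  rcases hs1 with hs1 | hs1
  · simp [hs1] at hs2
  · simp [hs1] at hr1

/-- Every facet of the trapezium lies on one of its four edge lines. -/
theorem facet_subset_edge_line {h : ℕ} {τ : Set (ℝ × ℝ)} (hτ : IsFacet (trapezium h) τ) :
    (∀ p ∈ τ, p.1 = 0) ∨ (∀ p ∈ τ, p.2 = 0) ∨ (∀ p ∈ τ, p.2 = 3) ∨
      (∀ p ∈ τ, p.1 + p.2 = h + 3) := by
  obtain ⟨hexp, hcol, hsub⟩ := hτ
  have hn : (0 : ℝ) ≤ h := h.cast_nonneg
  obtain ⟨l, hl⟩ := hexp (Set.not_subsingleton_iff.1 hsub).nonempty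
  have key : ∀ p ∈ τ, p ∈ trapezium h ∧ ∀ q ∈ trapezium h,
      q.1 * l (1, 0) + q.2 * l (0, 1) ≤ p.1 * l (1, 0) + p.2 * l (0, 1) := by
    intro p hp
    rw [hl] at hp
    refine ⟨hp.1, fun q hq => ?_⟩
    rw [← l.apply_eq_coordinates, ← l.apply_eq_coordinates]
    exact hp.2 q hq
  rcases lt_trichotomy (l (1, 0)) 0 with ha | ha | ha
  · left
    intro p hp
    obtain ⟨⟨h1, h2, h3, h4⟩, hmax⟩ := key p hp
    have := hmax (0, p.2) ⟨le_rfl, h2, h3, by simp; linarith⟩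
    simp only at this
    nlinarith
  · rcases lt_trichotomy (l (0, 1)) 0 with hb | hb | hb
    · right; left
      intro p hp
      obtain ⟨⟨h1, h2, h3, h4⟩, hmax⟩ := key p hp
      have := hmax (0, 0) ⟨le_rfl, le_rfl, by simp, by simp; linarith⟩
      simp only [ha] at this
      nlinarith
    · exfalso
      apply not_collinear_trapezium h
      convert hcol
      have hzero : ∀ p, l p = 0 := fun p => by rw [l.apply_eq_coordinates, ha, hb]; ring
      rw [hl]
      ext p
      simp [hzero]
    · right; right; left
      intro p hp
      obtain ⟨⟨h1, h2, h3, h4⟩, hmax⟩ := key p hp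
      have := hmax (0, 3) ⟨le_rfl, by simp, le_rfl, by simp⟩
      simp only [ha] at this
      nlinarith
  · right; right; right
    intro p hp
    obtain ⟨⟨h1, h2, h3, h4⟩, hmax⟩ := key p hp
    have := hmax (h + 3 - p.2, p.2) ⟨by simp only; linarith, h2, h3, by simp⟩
    simp only at this
    nlinarith

/-- The face of the trapezium on which a functional attains an upper bound is a facet as soon
as it contains two points and lies on a line. -/
theorem isFacet_of_forall_le {h : ℕ} (l : ℝ × ℝ →L[ℝ] ℝ) {c : ℝ}
    (hle : ∀ p ∈ trapezium h, l p ≤ c) {a b : ℝ × ℝ} (ha : a ∈ trapezium h)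
    (hb : b ∈ trapezium h) (hac : l a = c) (hbc : l b = c) (hab : a ≠ b) (v : ℝ × ℝ)
    (hline : ∀ p, l p = c → ∃ r : ℝ, p = r • v + a) :
    IsFacet (trapezium h) {p ∈ trapezium h | l p = c} := by
  refine ⟨fun _ => ⟨l, ?_⟩, ?_, fun hs => hab (hs ⟨ha, hac⟩ ⟨hb, hbc⟩)⟩
  · ext p
    constructor
    · rintro ⟨hp, hpc⟩
      refine ⟨hp, fun q hq => ?_⟩
      rw [hpc]
      exact hle q hq
    · rintro ⟨hp, hpm⟩
      exact ⟨hp, le_antisymm (hle p hp) (hac ▸ hpm a ha)⟩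
  · have hmem : a ∈ {p ∈ trapezium h | l p = c} := ⟨ha, hac⟩
    refine (collinear_iff_of_mem hmem).2 ⟨v, fun p hp => ?_⟩
    simpa using hline p hp.2

theorem isFacet_left (h : ℕ) : IsFacet (trapezium h) {p ∈ trapezium h | p.1 = 0} := by
  have := isFacet_of_forall_le (h := h) (-ContinuousLinearMap.fst ℝ ℝ ℝ) (c := 0)
    (fun p hp => by simpa using hp.1) (a := (0, 0)) (b := (0, 3))
    (by refine ⟨?_, ?_, ?_, ?_⟩ <;> simp; positivity) (by refine ⟨?_, ?_, ?_, ?_⟩ <;> simp)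
    (by simp) (by simp) (by simp) (0, 1)
    (fun p hp => ⟨p.2, by ext <;> simp at hp ⊢; exact hp⟩)
  simpa using this

theorem isFacet_bottom (h : ℕ) : IsFacet (trapezium h) {p ∈ trapezium h | p.2 = 0} := by
  have := isFacet_of_forall_le (h := h) (-ContinuousLinearMap.snd ℝ ℝ ℝ) (c := 0)
    (fun p hp => by simpa using hp.2.1) (a := (0, 0)) (b := (1, 0))
    (by refine ⟨?_, ?_, ?_, ?_⟩ <;> simp; positivity)
    (by have : (0 : ℝ) ≤ h := h.cast_nonneg
        refine ⟨?_, ?_, ?_, ?_⟩ <;> simp; linarith)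
    (by simp) (by simp) (by simp) (1, 0)
    (fun p hp => ⟨p.1, by ext <;> simp at hp ⊢; exact hp⟩)
  simpa using this

theorem isFacet_right (h : ℕ) :
    IsFacet (trapezium h) {p ∈ trapezium h | p.1 + p.2 = h + 3} := by
  have := isFacet_of_forall_le (h := h)
    (ContinuousLinearMap.fst ℝ ℝ ℝ + ContinuousLinearMap.snd ℝ ℝ ℝ) (c := h + 3)
    (fun p hp => hp.2.2.2) (a := (h + 3, 0)) (b := (h, 3))
    (by refine ⟨?_, ?_, ?_, ?_⟩ <;> simp; positivity) (by refine ⟨?_, ?_, ?_, ?_⟩ <;> simp)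
    (by simp) (by simp) (by simp) (-1, 1)
    (fun p hp => ⟨p.2, by
      simp at hp
      ext
      · simp; linarith
      · simp⟩)
  simpa using this

theorem isColumnVector_trapezium_iff {h : ℕ} (hh : 1 ≤ h) {v : ℤ × ℤ} :
    IsColumnVector (trapezium h) v ↔
      v ∈ ({(-1, 0), (1, 0), (0, -1), (1, -1)} : Finset (ℤ × ℤ)) := by
  obtain ⟨a, b⟩ := v
  simp only [Finset.mem_insert, Finset.mem_singleton, Prod.mk.injEq]
  constructor
  · rintro ⟨hv, τ, hτ, hcol⟩
    have hab : ¬ (a = 0 ∧ b = 0) := fun hab => hv (by simp [hab.1, hab.2])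
    have shift : ∀ x y : ℤ, (0 ≤ x ∧ 0 ≤ y ∧ y ≤ 3 ∧ x + y ≤ h + 3) → toR2 (x, y) ∉ τ →
        0 ≤ x + a ∧ 0 ≤ y + b ∧ y + b ≤ 3 ∧ x + a + (y + b) ≤ h + 3 := fun x y hxy hnot =>
      toR2_mem_trapezium.1 (hcol (x, y) ⟨toR2_mem_trapezium.2 hxy, hnot⟩)
    rcases facet_subset_edge_line hτ with hline | hline | hline | hline
    · have off : ∀ x y : ℤ, x ≠ 0 → toR2 (x, y) ∉ τ := fun x y hx hmem =>
        hx (by have := hline _ hmem; simp only [toR2] at this; exact_mod_cast this)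
      have h1 := shift 1 0 (by omega) (off _ _ (by omega))
      have h2 := shift 1 3 (by omega) (off _ _ (by omega))
      have h3 := shift (h + 3) 0 (by omega) (off _ _ (by omega))
      omega
    · have off : ∀ x y : ℤ, y ≠ 0 → toR2 (x, y) ∉ τ := fun x y hy hmem =>
        hy (by have := hline _ hmem; simp only [toR2] at this; exact_mod_cast this)
      have h1 := shift 0 1 (by omega) (off _ _ (by omega))
      have h2 := shift 0 3 (by omega) (off _ _ (by omega))
      have h3 := shift h 3 (by omega) (off _ _ (by omega))
      omega
    · have off : ∀ x y : ℤ, y ≠ 3 → toR2 (x, y) ∉ τ := fun x y hy hmem =>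
        hy (by have := hline _ hmem; simp only [toR2] at this; exact_mod_cast this)
      have h1 := shift 0 0 (by omega) (off _ _ (by omega))
      have h2 := shift (h + 3) 0 (by omega) (off _ _ (by omega))
      omega
    · have off : ∀ x y : ℤ, x + y ≠ h + 3 → toR2 (x, y) ∉ τ := fun x y hxy hmem =>
        hxy (by have := hline _ hmem; simp only [toR2] at this; exact_mod_cast this)
      have h1 := shift 0 0 (by omega) (off _ _ (by omega))
      have h2 := shift 0 3 (by omega) (off _ _ (by omega))
      have h3 := shift (h + 2) 0 (by omega) (off _ _ (by omega))
      omega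
  · rintro (⟨rfl, rfl⟩ | ⟨rfl, rfl⟩ | ⟨rfl, rfl⟩ | ⟨rfl, rfl⟩)
    · refine ⟨by simp, _, isFacet_left h, ?_⟩
      rintro ⟨x, y⟩ ⟨hp, hnot⟩
      have hx : x ≠ 0 := fun hx => hnot ⟨hp, by simp [toR2, hx]⟩
      simp only [toR2_mem_trapezium, Prod.mk_add_mk] at hp ⊢
      omega
    · refine ⟨by simp, _, isFacet_right h, ?_⟩
      rintro ⟨x, y⟩ ⟨hp, hnot⟩
      have hxy : x + y ≠ h + 3 := fun hxy => hnot ⟨hp, by simp only [toR2]; exact_mod_cast hxy⟩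
      simp only [toR2_mem_trapezium, Prod.mk_add_mk] at hp ⊢
      omega
    all_goals
      refine ⟨by simp, _, isFacet_bottom h, ?_⟩
      rintro ⟨x, y⟩ ⟨hp, hnot⟩
      have hy : y ≠ 0 := fun hy => hnot ⟨hp, by simp [toR2, hy]⟩
      simp only [toR2_mem_trapezium, Prod.mk_add_mk] at hp ⊢
      omega

theorem colCount_trapezium {h : ℕ} (hh : 1 ≤ h) : colCount (trapezium h) = 4 := by
  have heq : {v : ℤ × ℤ | IsColumnVector (trapezium h) v} =
      (({(-1, 0), (1, 0), (0, -1), (1, -1)} : Finset (ℤ × ℤ)) : Set (ℤ × ℤ)) := by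
    ext v
    exact isColumnVector_trapezium_iff hh
  rw [colCount, heq, Set.ncard_coe_finset]
  rfl

open Filter Topology in
theorem eventually_pos_add_mul {u w : ℝ} (huw : 0 < u ∨ u = 0 ∧ 0 < w) :
    ∀ᶠ ε in 𝓝[>] (0 : ℝ), 0 < u + ε * w := by
  rcases huw with hu | ⟨rfl, hw⟩
  · have hcont : Continuous fun ε : ℝ => u + ε * w := by fun_prop
    have hlim : Tendsto (fun ε : ℝ => u + ε * w) (𝓝 0) (𝓝 u) := by
      simpa using hcont.tendsto 0
    exact nhdsWithin_le_nhds (hlim.eventually (lt_mem_nhds hu))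
  · filter_upwards [self_mem_nhdsWithin] with ε hε
    have : 0 < ε := hε
    positivity

/-- If a convex set contains the trapezium and a point `q`, then it contains in its interior
every point of the trapezium all of whose active inequalities are violated at `q`. -/
theorem mem_interior_of_active_violated {h : ℕ} {s : Set (ℝ × ℝ)} (hs : Convex ℝ s)
    (hsub : trapezium h ⊆ s) {p q : ℝ × ℝ} (hq : q ∈ s)
    (hleft : 0 < p.1 ∨ p.1 = 0 ∧ q.1 < 0) (hbottom : 0 < p.2 ∨ p.2 = 0 ∧ q.2 < 0)
    (htop : p.2 < 3 ∨ p.2 = 3 ∧ 3 < q.2)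
    (hright : p.1 + p.2 < h + 3 ∨ p.1 + p.2 = h + 3 ∧ h + 3 < q.1 + q.2) :
    p ∈ interior s := by
  have e1 := eventually_pos_add_mul (u := p.1) (w := p.1 - q.1)
    (hleft.imp_right fun hp => ⟨hp.1, by linarith [hp.1, hp.2]⟩)
  have e2 := eventually_pos_add_mul (u := p.2) (w := p.2 - q.2)
    (hbottom.imp_right fun hp => ⟨hp.1, by linarith [hp.1, hp.2]⟩)
  have e3 := eventually_pos_add_mul (u := 3 - p.2) (w := q.2 - p.2)
    (htop.imp (fun hp => by linarith) fun hp => ⟨by linarith [hp.1], by linarith [hp.1, hp.2]⟩)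
  have e4 := eventually_pos_add_mul (u := h + 3 - (p.1 + p.2)) (w := q.1 + q.2 - (p.1 + p.2))
    (hright.imp (fun hp => by linarith) fun hp => ⟨by linarith [hp.1], by linarith [hp.1, hp.2]⟩)
  obtain ⟨ε, ⟨⟨⟨⟨h1, h2⟩, h3⟩, h4⟩, hε⟩⟩ :=
    ((((e1.and e2).and e3).and e4).and self_mem_nhdsWithin).exists
  have hε : 0 < ε := hε
  have hint : p + ε • (p - q) ∈ interior s := by
    apply interior_mono hsub
    rw [mem_interior_trapezium]
    simp only [Prod.fst_add, Prod.snd_add, Prod.smul_fst, Prod.smul_snd, Prod.fst_sub,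
      Prod.snd_sub, smul_eq_mul]
    refine ⟨h1, h2, ?_, ?_⟩ <;> linarith
  have hcombo := hs.combo_interior_self_mem_interior hint hq
    (show 0 < 1 / (1 + ε) by positivity) (show 0 ≤ ε / (1 + ε) by positivity) (by field_simp)
  convert hcombo using 1
  ext <;> simp <;> field_simp <;> ring

theorem isMaximalPolytope_trapezium {h : ℕ} (hh : 2 ≤ h) : IsMaximalPolytope (trapezium h) := by
  rintro Δ ⟨S, rfl⟩ hssub heq
  obtain ⟨q, hqS, hq⟩ : ∃ q ∈ S, toR2 q ∉ trapezium h := by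
    by_contra! hall
    refine hssub.2 (convexHull_min ?_ (convex_trapezium h))
    rintro _ ⟨q, hq, rfl⟩
    exact hall q hq
  have hqmem := subset_convexHull ℝ _ (Set.mem_image_of_mem toR2 (Finset.mem_coe.2 hqS))
  have interior_of_active : ∀ x y : ℤ, (0 < x ∨ x = 0 ∧ q.1 < 0) → (0 < y ∨ y = 0 ∧ q.2 < 0) →
      (y < 3 ∨ y = 3 ∧ 3 < q.2) → (x + y < h + 3 ∨ x + y = h + 3 ∧ h + 3 < q.1 + q.2) →
      0 < x ∧ 0 < y ∧ y < 3 ∧ x + y < h + 3 := by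
    intro x y hleft hbottom htop hright
    rw [← mem_intPts_trapezium (p := (x, y)), ← heq]
    refine mem_interior_of_active_violated (convex_convexHull ℝ _) hssub.1 hqmem ?_ ?_ ?_ ?_ <;>
      simp only [toR2] <;> assumption_mod_cast
  rw [toR2_mem_trapezium] at hq
  by_cases h1 : q.1 < 0
  · have := interior_of_active 0 1 (by omega) (by omega) (by omega) (by omega)
    omega
  by_cases h2 : q.2 < 0
  · have := interior_of_active 1 0 (by omega) (by omega) (by omega) (by omega)
    omega
  by_cases h3 : 3 < q.2
  · have := interior_of_active 1 3 (by omega) (by omega) (by omega) (by omega)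
    omega
  · have := interior_of_active (h + 2) 1 (by omega) (by omega) (by omega) (by omega)
    omega

/-- for every integer `h ≥ 2`, the trapezium
`Δ = conv{(0,0),(0,3),(h,3),(h+3,0)}` has `4h+10` lattice points, exactly `2h+1`
interior lattice points, `c(Δ) = 4`, and is maximal. -/
theorem trapezium_counts (h : ℕ) (hh : 2 ≤ h) :
    (latticePts (convexHull ℝ
        ({((0 : ℝ), (0 : ℝ)), (0, 3), (((h : ℕ) : ℝ), 3), (((h + 3 : ℕ) : ℝ), 0)} :
          Set (ℝ × ℝ)))).ncard = 4 * h + 10 ∧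
    (intPts (convexHull ℝ
        ({((0 : ℝ), (0 : ℝ)), (0, 3), (((h : ℕ) : ℝ), 3), (((h + 3 : ℕ) : ℝ), 0)} :
          Set (ℝ × ℝ)))).ncard = 2 * h + 1 ∧
    colCount (convexHull ℝ
        ({((0 : ℝ), (0 : ℝ)), (0, 3), (((h : ℕ) : ℝ), 3), (((h + 3 : ℕ) : ℝ), 0)} :
          Set (ℝ × ℝ))) = 4 ∧
    IsMaximalPolytope (convexHull ℝ
        ({((0 : ℝ), (0 : ℝ)), (0, 3), (((h : ℕ) : ℝ), 3), (((h + 3 : ℕ) : ℝ), 0)} :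
          Set (ℝ × ℝ))) := by
  rw [convexHull_vertices_eq_trapezium]
  exact ⟨ncard_latticePts_trapezium h, ncard_intPts_trapezium h, colCount_trapezium (by omega),
    isMaximalPolytope_trapezium hh⟩
end
end

section
/- Let k be a field of characteristic different from 2 and let p ∈ k[x] be a squarefree polynomial of degree d ≥ 3 (i.e., p has no repeated roots in an algebraic closure of k). Then the polynomial f(x,y) = y² − p(x), regarded as a Laurent polynomial in k[x^{±1}, y^{±1}], is nondegenerate with respect to its Newton polytope. -/
noncomputable section
open scoped Classical

/-- The Newton polytope of the Laurent polynomial `f = Σ c_{ij} x^i y^j`, given by its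
coefficient function `c : ℤ × ℤ → k`: the convex hull in `ℝ²` of the support of `c`. -/
def newtonPolytope {k : Type*} [Field k] (c : ℤ × ℤ → k) : Set (ℝ × ℝ) :=
  convexHull ℝ (toR2 '' Function.support c)

/-- The sum `Σ_{(i,j) ∈ τ ∩ ℤ²} w(i,j) · c_{ij} · x^i y^j` of the terms of `f`
supported on the face `τ`, weighted by `w`, evaluated at a point `(x, y)` of the torus
over the algebraic closure of `k`.  Taking `w = 1`, `w = i` and `w = j` gives
respectively `f|_τ`, `x·∂(f|_τ)/∂x` and `y·∂(f|_τ)/∂y` evaluated at `(x, y)`. -/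
def faceSum {k : Type*} [Field k] (c : ℤ × ℤ → k) (τ : Set (ℝ × ℝ))
    (w : ℤ × ℤ → AlgebraicClosure k) (x y : (AlgebraicClosure k)ˣ) :
    AlgebraicClosure k :=
  ∑ᶠ p : ℤ × ℤ,
    if toR2 p ∈ τ then
      w p * algebraMap k (AlgebraicClosure k) (c p) *
        ((x ^ p.1 : (AlgebraicClosure k)ˣ) : AlgebraicClosure k) *
        ((y ^ p.2 : (AlgebraicClosure k)ˣ) : AlgebraicClosure k)
    else 0

/-- The Laurent polynomial with coefficient function `c` is nondegenerate with respect
to its Newton polytope: for every face `τ` of `Δ(f)` (of any dimension, including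
`Δ(f)` itself), the system `f|_τ = x·∂(f|_τ)/∂x = y·∂(f|_τ)/∂y = 0` has no solution
in the torus `(k̄*)²` over the algebraic closure `k̄` of `k`. -/
def Nondegenerate {k : Type*} [Field k] (c : ℤ × ℤ → k) : Prop :=
  ∀ τ : Set (ℝ × ℝ), τ.Nonempty → IsExposed ℝ (newtonPolytope c) τ →
    ∀ x y : (AlgebraicClosure k)ˣ,
      ¬ (faceSum c τ (fun _ => 1) x y = 0 ∧
         faceSum c τ (fun p => (p.1 : AlgebraicClosure k)) x y = 0 ∧
         faceSum c τ (fun p => (p.2 : AlgebraicClosure k)) x y = 0)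

/-- The coefficient function of the Laurent polynomial `y² − p(x)`. -/
def sqSubCoeff {k : Type*} [Field k] (p : Polynomial k) : ℤ × ℤ → k := fun q =>
  if q = ((0 : ℤ), (2 : ℤ)) then 1
  else if q.2 = 0 ∧ 0 ≤ q.1 then -(p.coeff q.1.toNat) else 0

section sqSubCoeff

variable {k : Type*} [Field k] (p : Polynomial k)

lemma sqSubCoeff_zero_two : sqSubCoeff p (0, 2) = 1 := by simp [sqSubCoeff]

lemma sqSubCoeff_natCast_zero (i : ℕ) : sqSubCoeff p ((i : ℤ), 0) = -p.coeff i := by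
  simp [sqSubCoeff]

lemma eq_of_sqSubCoeff_ne_zero {q : ℤ × ℤ} (hq : sqSubCoeff p q ≠ 0) :
    q = (0, 2) ∨ ∃ i ∈ p.support, q = ((i : ℤ), 0) := by
  obtain ⟨a, b⟩ := q
  unfold sqSubCoeff at hq
  split_ifs at hq with h₁ h₂
  · exact Or.inl h₁
  · obtain ⟨rfl, ha⟩ : b = 0 ∧ 0 ≤ a := h₂
    lift a to ℕ using ha
    exact Or.inr ⟨a, by simpa using hq, rfl⟩
  · exact absurd rfl hq

/-- The face sums of `y² − p(x)`, written as a sum over the support of `p`. -/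
lemma faceSum_sqSubCoeff (τ : Set (ℝ × ℝ)) (w : ℤ × ℤ → AlgebraicClosure k)
    (x y : (AlgebraicClosure k)ˣ) :
    faceSum (sqSubCoeff p) τ w x y =
      (if toR2 (0, 2) ∈ τ then w (0, 2) * (y : AlgebraicClosure k) ^ 2 else 0) -
      ∑ i ∈ p.support, if toR2 ((i : ℤ), 0) ∈ τ then
        w ((i : ℤ), 0) * algebraMap k (AlgebraicClosure k) (p.coeff i) *
          (x : AlgebraicClosure k) ^ i else 0 := by
  unfold faceSum
  rw [finsum_eq_sum_of_support_subset
    (s := insert (0, 2) (p.support.image fun i : ℕ => ((i : ℤ), (0 : ℤ))))]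
  · rw [Finset.sum_insert (by simp), Finset.sum_image (by simp [Set.InjOn]), sub_eq_add_neg,
      ← Finset.sum_neg_distrib]
    congr 1
    · simp only [sqSubCoeff_zero_two, map_one, mul_one, zpow_zero, Units.val_one]
      norm_cast
    · refine Finset.sum_congr rfl fun i _ => ?_
      simp only [sqSubCoeff_natCast_zero]
      split_ifs <;> simp
  · intro q hq
    have hc : sqSubCoeff p q ≠ 0 := by
      rintro h
      simp [h] at hq
    rcases eq_of_sqSubCoeff_ne_zero p hc with rfl | ⟨i, hi, rfl⟩
    · simp
    · simpa using hi

end sqSubCoeff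

/-- A nonempty exposed face of the Newton polytope is cut out by a linear functional `l`: it
contains a point of the support, and an exponent vector `q` of the support lies on it as soon as
`l` is at least as large at `q` as at some point of the face. -/
lemma exists_functional_of_isExposed_newtonPolytope {k : Type*} [Field k] {c : ℤ × ℤ → k}
    {τ : Set (ℝ × ℝ)} (hne : τ.Nonempty) (hτ : IsExposed ℝ (newtonPolytope c) τ) :
    ∃ l : ℝ × ℝ →L[ℝ] ℝ, (∃ q, c q ≠ 0 ∧ toR2 q ∈ τ) ∧
      (∀ q, c q ≠ 0 → ∀ z ∈ τ, l z ≤ l (toR2 q) → toR2 q ∈ τ) ∧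
      ∀ z ∈ τ, ∀ z' ∈ τ, l z = l z' := by
  obtain ⟨l, rfl⟩ := hτ hne
  have hsub : ∀ q, c q ≠ 0 → toR2 q ∈ newtonPolytope c := fun q hq =>
    subset_convexHull ℝ _ ⟨q, hq, rfl⟩
  have hmem : ∀ q, c q ≠ 0 → ∀ z ∈ {z ∈ newtonPolytope c | ∀ y ∈ newtonPolytope c, l y ≤ l z},
      l z ≤ l (toR2 q) →
      toR2 q ∈ {z ∈ newtonPolytope c | ∀ y ∈ newtonPolytope c, l y ≤ l z} :=
    fun q hq z hz hle => ⟨hsub q hq, fun y hy => (hz.2 y hy).trans hle⟩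
  refine ⟨l, ?_, hmem, fun z hz z' hz' => le_antisymm (hz'.2 z hz.1) (hz.2 z' hz'.1)⟩
  obtain ⟨z, hz⟩ := hne
  by_contra! hno
  have hlt : newtonPolytope c ⊆ {v | l v < l z} := by
    refine convexHull_min ?_ (convex_halfSpace_lt l.toLinearMap.isLinear _)
    rintro _ ⟨q, hq, rfl⟩
    exact not_le.1 fun hle => hno q hq (hmem q hq z hz hle)
  exact lt_irrefl (l z) (hlt hz.1)

/-- A squarefree polynomial over an algebraically closed field has no common zero with its
derivative; here the two are expanded as sums over the support. -/
lemma no_common_zero_of_squarefree_map {k : Type*} [Field k] {p : Polynomial k}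
    (hsf : Squarefree (p.map (algebraMap k (AlgebraicClosure k)))) {x : AlgebraicClosure k}
    (h₀ : ∑ i ∈ p.support, algebraMap k (AlgebraicClosure k) (p.coeff i) * x ^ i = 0)
    (h₁ : ∑ i ∈ p.support,
      (i : AlgebraicClosure k) * algebraMap k (AlgebraicClosure k) (p.coeff i) * x ^ i = 0)
    (hx : x ≠ 0) : False := by
  have hsep : p.Separable :=
    Polynomial.separable_map _ |>.1 (PerfectField.separable_iff_squarefree.2 hsf)
  have hp : p.eval₂ (algebraMap k (AlgebraicClosure k)) x = 0 := by
    rw [Polynomial.eval₂_eq_sum, Polynomial.sum]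
    exact h₀
  refine hsep.eval₂_derivative_ne_zero _ hp ?_
  have hd : x * p.derivative.eval₂ (algebraMap k (AlgebraicClosure k)) x = 0 := by
    rw [← h₁, Polynomial.derivative_apply, Polynomial.sum, Polynomial.eval₂_finsetSum,
      Finset.mul_sum]
    refine Finset.sum_congr rfl fun i _ => ?_
    rcases i with _ | i
    · simp
    · simp [pow_succ]
      ring
  exact (mul_eq_zero.1 hd).resolve_left hx

/-- over a field `k` of characteristic `≠ 2`, if `p ∈ k[x]` has degree
`≥ 3` and no repeated roots in an algebraic closure of `k`, then
`f(x,y) = y² − p(x)`, regarded as a Laurent polynomial, is nondegenerate with respect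
to its Newton polytope. -/
theorem nondegenerate_of_squarefree (k : Type*) [Field k] (hchar : ringChar k ≠ 2)
    (p : Polynomial k) (hdeg : 3 ≤ p.natDegree)
    (hsf : Squarefree (p.map (algebraMap k (AlgebraicClosure k)))) :
    Nondegenerate (fun q : ℤ × ℤ =>
      if q = ((0 : ℤ), (2 : ℤ)) then 1
      else if q.2 = 0 ∧ 0 ≤ q.1 then -(p.coeff q.1.toNat) else 0) := by
  intro τ hne hτ x y
  change ¬ (faceSum (sqSubCoeff p) τ _ x y = 0 ∧ faceSum (sqSubCoeff p) τ _ x y = 0 ∧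
    faceSum (sqSubCoeff p) τ _ x y = 0)
  change IsExposed ℝ (newtonPolytope (sqSubCoeff p)) τ at hτ
  rintro ⟨h₀, h₁, h₂⟩
  rw [faceSum_sqSubCoeff] at h₀ h₁ h₂
  have h_two : (2 : AlgebraicClosure k) ≠ 0 := by
    rw [← map_ofNat (algebraMap k (AlgebraicClosure k)) 2]
    exact (map_ne_zero _).2 (Ring.two_ne_zero hchar)
  have htop : toR2 (0, 2) ∉ τ := fun h => by
    simp [h, h_two] at h₂
  simp only [if_neg htop, zero_sub, neg_eq_zero, one_mul, Int.cast_natCast] at h₀ h₁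
  obtain ⟨l, ⟨q, hq, hqτ⟩, hmem, heq⟩ := exists_functional_of_isExposed_newtonPolytope hne hτ
  obtain rfl | ⟨i, hi, rfl⟩ := eq_of_sqSubCoeff_ne_zero p hq
  · exact htop hqτ
  have hl : ∀ j : ℕ, l (toR2 ((j : ℤ), 0)) = j * l (1, 0) := fun j => by
    rw [← smul_eq_mul, ← map_smul]
    simp [toR2]
  by_cases ha : l (1, 0) = 0
  · have hall : ∀ j ∈ p.support, toR2 ((j : ℤ), 0) ∈ τ := fun j hj =>
      hmem _ (by simpa [sqSubCoeff_natCast_zero] using hj) _ hqτ (by simp [hl, ha])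
    rw [Finset.sum_congr rfl fun j hj => if_pos (hall j hj)] at h₀ h₁
    exact no_common_zero_of_squarefree_map hsf h₀ h₁ x.ne_zero
  · have huniq : ∀ j ∈ p.support, j ≠ i → toR2 ((j : ℤ), 0) ∉ τ := fun j _ hji hj => by
      have := heq _ hj _ hqτ
      rw [hl, hl] at this
      exact hji (by exact_mod_cast mul_right_cancel₀ ha this)
    rw [Finset.sum_eq_single_of_mem i hi fun j hj hji => if_neg (huniq j hj hji),
      if_pos hqτ] at h₀
    simp [Polynomial.mem_support_iff.1 hi] at h₀
end
end
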